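/- Let f be a transcendental entire function whose singular set S(f) is finite, and suppose f has the area property: for every compact set K ⊆ ℂ∖S(f), the integral ∫_{f⁻¹(K)∖𝔻} dx dy/|z|² is finite (𝔻 the open unit disc). Then for every entire function g that is topologically equivalent to f, one has ρ(f) = ρ(g). -/

import Mathlib

open Complex Set Filter Topology Metric MeasureTheory
open scoped ENNReal Real

noncomputable def logPlus (x : ℝ) : ℝ := max 0 (Real.log x)

noncomputable def entireOrder (f : ℂ → ℂ) : ℝ≥0∞ :=
  Filter.limsup
    (fun z : ℂ => ENNReal.ofReal (logPlus (logPlus ‖f z‖) / Real.log ‖z‖))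
    (Filter.comap (fun z : ℂ => ‖z‖) Filter.atTop)

def IsRegularValue (f : ℂ → ℂ) (w : ℂ) : Prop :=
  ∃ U : Set ℂ, IsOpen U ∧ w ∈ U ∧
    ∀ z ∈ f ⁻¹' U,
      ∃ e : ↥(connectedComponentIn (f ⁻¹' U) z) ≃ₜ ↥U,
        ∀ x : ↥(connectedComponentIn (f ⁻¹' U) z), (e x : ℂ) = f ↑x

def singularSet (f : ℂ → ℂ) : Set ℂ := {w : ℂ | ¬ IsRegularValue f w}

def TranscendentalEntire (f : ℂ → ℂ) : Prop :=
  Differentiable ℂ f ∧ ¬ ∃ p : Polynomial ℂ, ∀ z, f z = p.eval z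

def TopEquiv (f g : ℂ → ℂ) : Prop :=
  ∃ φ ψ : ℂ ≃ₜ ℂ, ∀ z, ψ (f z) = g (φ z)

noncomputable def cylArea (A : Set ℂ) : ℝ≥0∞ :=
  ∫⁻ z in A, ENNReal.ofReal (1 / ‖z‖ ^ 2)

def AreaProperty (f : ℂ → ℂ) : Prop :=
  ∀ K : Set ℂ, IsCompact K → K ⊆ (singularSet f)ᶜ →
    cylArea (f ⁻¹' K \ Metric.ball (0 : ℂ) 1) < ⊤

/-- A regular value has a neighbourhood all of whose sheets carry inverse branches. -/
theorem IsRegularValue.exists_branches {f : ℂ → ℂ} (hf : Continuous f) {w : ℂ}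
    (hw : IsRegularValue f w) :
    ∃ U : Set ℂ, IsOpen U ∧ w ∈ U ∧ ∃ F : ℂ → ℂ → ℂ,
      (∀ z, f z ∈ U → ContinuousOn (F z) U ∧ (∀ u ∈ U, f (F z u) = u) ∧ F z (f z) = z ∧
        IsOpen (F z '' U)) ∧
      ∀ z z' u, f z ∈ U → f z' ∈ U → u ∈ U → F z u = F z' u → EqOn (F z) (F z') U := by
  classical
  obtain ⟨U, hU, hwU, h⟩ := hw
  choose e he using h
  let F : ℂ → ℂ → ℂ := fun z u =>
    if h : f z ∈ U ∧ u ∈ U then ((e z h.1).symm ⟨u, h.2⟩ : ℂ) else 0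
  have hF : ∀ z (hz : f z ∈ U) u (h : u ∈ U), F z u = ((e z hz).symm ⟨u, h⟩ : ℂ) :=
    fun z hz u h => by simp [F, h, hz]
  have hC : ∀ z, f z ∈ U → ∀ u ∈ U, F z u ∈ connectedComponentIn (f ⁻¹' U) z := by
    intro z hz u hu
    rw [hF z hz u hu]; exact ((e z hz).symm ⟨u, hu⟩).2
  have hinv : ∀ z, f z ∈ U → ∀ u ∈ U, f (F z u) = u := by
    intro z hz u hu
    rw [hF z hz u hu, ← he z hz]; simp
  have hinj : ∀ z, f z ∈ U → ∀ y ∈ connectedComponentIn (f ⁻¹' U) z, F z (f y) = y := by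
    intro z hz y hy
    have hyU : f y ∈ U := connectedComponentIn_subset (f ⁻¹' U) z hy
    rw [hF z hz _ hyU]
    have : (⟨f y, hyU⟩ : U) = e z hz ⟨y, hy⟩ := Subtype.ext (he z hz ⟨y, hy⟩).symm
    rw [this]; simp
  refine ⟨U, hU, hwU, F, ?_, ?_⟩
  · intro z hz
    refine ⟨?_, hinv z hz, hinj z hz z (mem_connectedComponentIn hz), ?_⟩
    · rw [continuousOn_iff_continuous_domRestrict]
      have : U.domRestrict (F z) = fun u => ((e z hz).symm u : ℂ) := by
        ext u; simp [hF z hz u.1 u.2]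
      rw [this]; fun_prop
    · have : F z '' U = connectedComponentIn (f ⁻¹' U) z := by
        ext y; constructor
        · rintro ⟨u, hu, rfl⟩; exact hC z hz u hu
        · intro hy; exact ⟨f y, connectedComponentIn_subset (f ⁻¹' U) z hy, hinj z hz y hy⟩
      rw [this]; exact (hU.preimage hf).connectedComponentIn
  · intro z z' u hz hz' hu hzz v hv
    have h1 := hC z hz u hu
    have h2 := hC z' hz' u hu
    rw [hzz] at h1
    have h3 : connectedComponentIn (f ⁻¹' U) z = connectedComponentIn (f ⁻¹' U) z' :=
      (connectedComponentIn_eq h1).trans (connectedComponentIn_eq h2).symm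
    have h4 := hC z hz v hv
    rw [h3] at h4
    have := hinj z' hz' _ h4
    rw [hinv z hz v hv] at this
    exact this.symm

theorem isCoveringMapOn_compl_of_singularSet_subset {f : ℂ → ℂ} (hf : Continuous f) {S : Set ℂ}
    (hS : singularSet f ⊆ S) : IsCoveringMapOn f Sᶜ := by
  intro w hw
  have hreg : IsRegularValue f w := by
    by_contra h; exact hw (hS h)
  obtain ⟨U, hU, hwU, F, hF, hFF⟩ := hreg.exists_branches hf
  have hfib : ∀ z : f ⁻¹' {w}, f z ∈ U := fun z => by
    have : f z = w := z.2
    rwa [this]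
  have hdisc : DiscreteTopology (f ⁻¹' {w}) := by
    rw [discreteTopology_iff_isOpen_singleton]
    intro z
    refine ⟨F z '' U, (hF z (hfib z)).2.2.2, ?_⟩
    ext y
    simp only [mem_preimage, mem_image, mem_singleton_iff]
    constructor
    · rintro ⟨u, hu, huy⟩
      have h1 := (hF z (hfib z)).2.1 u hu
      rw [huy] at h1
      have h2 : f y = w := y.2
      have h3 : f z = w := z.2
      have h4 := (hF z (hfib z)).2.2.1
      rw [h3] at h4
      rw [h1.symm.trans h2, h4] at huy
      exact Subtype.ext huy.symm
    · rintro rfl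
      exact ⟨f y, hfib y, (hF y (hfib y)).2.2.1⟩
  refine ⟨hdisc, U, hwU, hU, hU.preimage hf, ?_⟩
  refine ⟨{ toFun := fun x => (⟨f x, x.2⟩, ⟨F x w, (hF x x.2).2.1 w hwU⟩)
            invFun := fun p => ⟨F p.2 p.1, by
              have := (hF p.2 (hfib p.2)).2.1 p.1 p.1.2
              rw [mem_preimage, this]; exact p.1.2⟩
            left_inv := ?_
            right_inv := ?_
            continuous_toFun := ?_
            continuous_invFun := ?_ }, fun x => rfl⟩
  · intro x
    apply Subtype.ext
    change F (F x w) (f x) = x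
    have h0 : f (F x w) ∈ U := by rw [(hF x x.2).2.1 w hwU]; exact hwU
    have h1 : F (F x w) w = F x w := by
      have := (hF (F x w) h0).2.2.1
      rwa [(hF x x.2).2.1 w hwU] at this
    rw [hFF _ _ w h0 x.2 hwU h1 x.2, (hF x x.2).2.2.1]
  · rintro ⟨u, z⟩
    have h1 : f (F z u) = u := (hF z (hfib z)).2.1 u u.2
    have hz : f z = w := z.2
    ext
    · exact h1
    · change F (F z u) w = z
      have h0 : f (F z u) ∈ U := by rw [h1]; exact u.2
      have h2 : F (F z u) u = F z u := by
        have := (hF (F z u) h0).2.2.1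
        rwa [h1] at this
      rw [hFF _ _ u h0 (hfib z) u.2 h2 hwU]
      have := (hF z (hfib z)).2.2.1
      rwa [hz] at this
  · refine Continuous.prodMk (by fun_prop) ?_
    rw [continuous_iff_continuousAt]
    intro x
    apply ContinuousAt.congr (continuousAt_const (y := (⟨F x w, (hF x x.2).2.1 w hwU⟩ : f ⁻¹' {w})))
    have hx : (Subtype.val ⁻¹' (F x '' U) : Set (f ⁻¹' U)) ∈ 𝓝 x :=
      ((hF x x.2).2.2.2.preimage continuous_subtype_val).mem_nhds
        ⟨f x, x.2, (hF x x.2).2.2.1⟩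
    filter_upwards [hx] with y hy
    obtain ⟨u, hu, huy⟩ := hy
    apply Subtype.ext
    change F x w = F y w
    have h1 : f y = u := by rw [← huy]; exact (hF x x.2).2.1 u hu
    have h2 : F y u = y := by rw [← h1]; exact (hF y y.2).2.2.1
    exact hFF x y u x.2 y.2 hu (by rw [h2, huy]) hwU
  · apply Continuous.subtype_mk
    rw [continuous_iff_continuousAt]
    rintro ⟨u, z⟩
    have h1 : ContinuousAt (fun p : U × (f ⁻¹' {w}) => F z p.1) (u, z) := by
      have h2 : ContinuousAt (F z) u := (hF z (hfib z)).1.continuousAt (hU.mem_nhds u.2)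
      exact h2.comp (f := fun p : U × (f ⁻¹' {w}) => (p.1 : ℂ)) (x := (u, z)) (by fun_prop)
    refine h1.congr ?_
    have : (univ : Set U) ×ˢ ({z} : Set (f ⁻¹' {w})) ∈ 𝓝 (u, z) :=
      prod_mem_nhds univ_mem ((isOpen_discrete _).mem_nhds rfl)
    filter_upwards [this] with p hp
    have : p.2 = z := hp.2
    rw [this]

theorem exists_sphere_forall_ne {f : ℂ → ℂ} (hf : Differentiable ℂ f)
    (hnc : ¬ ∃ c, ∀ z, f z = c) (z₀ : ℂ) {ε : ℝ} (hε : 0 < ε) :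
    ∃ r, 0 < r ∧ r < ε ∧ ∀ z ∈ sphere z₀ r, f z ≠ f z₀ := by
  have hfa : AnalyticOnNhd ℂ f univ := fun z _ => hf.analyticAt z
  have h : ∀ᶠ z in 𝓝[≠] z₀, f z ≠ f z₀ := by
    rcases (hfa z₀ trivial).eventually_eq_or_eventually_ne analyticAt_const (g := fun _ => f z₀)
      with h | h
    · exact absurd ⟨f z₀, fun z => congrFun (hfa.eq_of_eventuallyEq
        (fun _ _ => analyticAt_const) h) z⟩ hnc
    · exact h
  rw [eventually_nhdsWithin_iff, Metric.eventually_nhds_iff] at h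
  obtain ⟨δ, hδ, h⟩ := h
  refine ⟨min δ ε / 2, by positivity, ?_, ?_⟩
  · have := min_le_right δ ε
    linarith [lt_min hδ hε]
  · intro z hz
    rw [mem_sphere] at hz
    have h0 := lt_min hδ hε
    refine h ?_ ?_
    · have := min_le_left δ ε
      linarith
    · rintro rfl
      rw [dist_self] at hz
      linarith

/-- Homotopy lifting through an entire function, where the homotopy is stationary
at the points lying over the exceptional set. -/
theorem exists_lift_homotopy {f : ℂ → ℂ} (hf : Differentiable ℂ f) (hnc : ¬ ∃ c, ∀ z, f z = c)
    {S : Set ℂ} (hSf : S.Finite) (hS : singularSet f ⊆ S)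
    {X : Type*} [TopologicalSpace X] (H : C(unitInterval × X, ℂ)) (l : C(X, ℂ))
    (h0 : ∀ x, f (l x) = H (0, x))
    (hgood : ∀ x, H (0, x) ∉ S → ∀ t, H (t, x) ∉ S)
    (hbad : ∀ x, H (0, x) ∈ S → ∀ t, H (t, x) = H (0, x)) :
    ∃ L : C(unitInterval × X, ℂ), (∀ p, f (L p) = H p) ∧ (∀ x, L (0, x) = l x) ∧
      ∀ x, H (0, x) ∈ S → ∀ t, L (t, x) = l x := by
  classical
  have hcov : IsCoveringMap (Sᶜ.restrictPreimage f) :=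
    (isCoveringMapOn_compl_of_singularSet_subset hf.continuous hS).isCoveringMap_restrictPreimage
  let A := {x : X | H (0, x) ∉ S}
  have hAo : IsOpen A := hSf.isClosed.isOpen_compl.preimage (by fun_prop : Continuous fun x => H (0, x))
  let H' : C(unitInterval × A, (Sᶜ : Set ℂ)) :=
    ⟨fun p => ⟨H (p.1, p.2), hgood p.2 p.2.2 p.1⟩, by fun_prop⟩
  let l' : C(A, f ⁻¹' Sᶜ) := ⟨fun x => ⟨l x, by
    rw [mem_preimage, h0]; exact x.2⟩, by fun_prop⟩
  have H'0 : ∀ a, H' (0, a) = Sᶜ.restrictPreimage f (l' a) := fun a => Subtype.ext (h0 a).symm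
  let L' := hcov.liftHomotopy H' l' H'0
  have hL'1 : ∀ p, f (L' p) = H' p := fun p =>
    congrArg Subtype.val (congrFun (hcov.liftHomotopy_lifts H' l' H'0) p)
  have hL'0 : ∀ a, (L' (0, a) : ℂ) = l a := fun a =>
    congrArg Subtype.val (hcov.liftHomotopy_zero H' l' H'0 a)
  let L : unitInterval × X → ℂ := fun p => if h : p.2 ∈ A then L' (p.1, ⟨p.2, h⟩) else l p.2
  have hLg : ∀ t x (h : x ∈ A), L (t, x) = L' (t, ⟨x, h⟩) := fun t x h => by simp [L, h]
  have hLb : ∀ t x, x ∉ A → L (t, x) = l x := fun t x h => by simp [L, h]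
  have hL0 : ∀ x, L (0, x) = l x := fun x => by
    by_cases h : x ∈ A
    · rw [hLg _ _ h, hL'0]
    · rw [hLb _ _ h]
  have hLf : ∀ p, f (L p) = H p := by
    rintro ⟨t, x⟩
    by_cases h : x ∈ A
    · rw [hLg _ _ h, hL'1]; rfl
    · rw [hLb _ _ h, h0]; exact (hbad x (not_not.1 h) t).symm
  have hLt : ∀ x, Continuous fun t => L (t, x) := by
    intro x
    by_cases h : x ∈ A
    · simp_rw [hLg _ x h]; fun_prop
    · simp_rw [hLb _ x h]; fun_prop
  have hcont : Continuous L := by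
    rw [continuous_iff_continuousAt]
    rintro ⟨t₀, x₀⟩
    by_cases hx : x₀ ∈ A
    · have hemb : IsOpenEmbedding (Prod.map id Subtype.val : unitInterval × A → unitInterval × X) :=
        IsOpenEmbedding.id.prodMap hAo.isOpenEmbedding_subtypeVal
      refine (hemb.continuousAt_iff (g := L) (x := (t₀, ⟨x₀, hx⟩))).1 ?_
      have h2 : L ∘ (Prod.map id Subtype.val : unitInterval × A → unitInterval × X)
          = fun p => (L' p : ℂ) := by
        ext ⟨t, x⟩; exact hLg t x x.2
      rw [h2]; fun_prop
    · rw [Metric.continuousAt_iff']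
      intro ε hε
      obtain ⟨r, hr, hrε, hne⟩ := exists_sphere_forall_ne hf hnc (l x₀) hε
      have hs : f (l x₀) = H (0, x₀) := h0 x₀
      obtain ⟨η, hη, hfar⟩ : ∃ η > 0, ∀ z ∈ sphere (l x₀) r, η ≤ dist (f z) (H (0, x₀)) := by
        have hcomp : IsCompact (sphere (l x₀) r) := isCompact_sphere _ _
        obtain ⟨z, hz, hmin⟩ := hcomp.exists_isMinOn
          (NormedSpace.sphere_nonempty.2 hr.le)
          (f := fun z => dist (f z) (H (0, x₀))) (by have := hf.continuous; fun_prop)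
        exact ⟨_, dist_pos.2 (hs ▸ hne z hz), fun y hy => hmin hy⟩
      have hopen : IsOpen {p : unitInterval × X | dist (H p) (H (0, x₀)) < η} :=
        isOpen_lt (by fun_prop) continuous_const
      obtain ⟨u, v, -, hv, hu, hxv, huv⟩ := generalized_tube_lemma (s := (univ : Set unitInterval))
        isCompact_univ (t := {x₀}) isCompact_singleton hopen (by
          rintro ⟨t, x⟩ ⟨-, hx'⟩
          rw [mem_singleton_iff] at hx'
          simp only at hx'
          subst hx'
          rw [mem_ofPred_eq, hbad x (not_not.1 hx) t, dist_self]
          exact hη)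
      have hN : v ∩ l ⁻¹' ball (l x₀) r ∈ 𝓝 x₀ :=
        inter_mem (hv.mem_nhds (hxv rfl)) (l.continuous.continuousAt (ball_mem_nhds _ hr))
      filter_upwards [prod_mem_nhds (x := t₀) (univ_mem) hN]
      rintro ⟨t, x⟩ ⟨-, hxv', hxl⟩
      rw [hLb _ _ hx]
      refine lt_trans ?_ hrε
      by_contra hge
      rw [not_lt] at hge
      have hivt := intermediate_value_univ (0 : unitInterval) t
        (f := fun t => dist (L (t, x)) (l x₀)) ((hLt x).dist continuous_const)
      obtain ⟨t', ht'⟩ := hivt ⟨by rw [hL0]; exact (mem_ball.1 hxl).le, hge⟩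
      have h5 := hfar _ (mem_sphere.2 ht')
      rw [hLf] at h5
      have h6 := @huv (t', x) ⟨hu trivial, hxv'⟩
      exact absurd h5 (not_le.2 h6)
  exact ⟨⟨L, hcont⟩, hLf, hL0, fun x hx t => hLb t x (not_not.2 hx)⟩

/-- Uniqueness of lifts of paths avoiding the exceptional set. -/
theorem eq_of_lift_eq {f : ℂ → ℂ} (hf : Continuous f)
    {S : Set ℂ} (hS : singularSet f ⊆ S) {Γ₁ Γ₂ : unitInterval → ℂ} (h₁ : Continuous Γ₁)
    (h₂ : Continuous Γ₂) (h : ∀ t, f (Γ₁ t) = f (Γ₂ t)) (hn : ∀ t, f (Γ₁ t) ∉ S)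
    {t₀ : unitInterval} (h0 : Γ₁ t₀ = Γ₂ t₀) (t : unitInterval) : Γ₁ t = Γ₂ t := by
  have hcov : IsCoveringMap (Sᶜ.restrictPreimage f) :=
    (isCoveringMapOn_compl_of_singularSet_subset hf hS).isCoveringMap_restrictPreimage
  have := hcov.eq_of_comp_eq (A := unitInterval) (g₁ := fun t => ⟨Γ₁ t, hn t⟩)
    (g₂ := fun t => ⟨Γ₂ t, by rw [mem_preimage, ← h]; exact hn t⟩) (by fun_prop) (by fun_prop)
    (by ext t; exact h t) t₀ (Subtype.ext h0)
  exact congrArg Subtype.val (congrFun this t)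

theorem exists_continuous_log {X : Type*} [NormedAddCommGroup X] [NormedSpace ℝ X]
    {g : X → ℂ} (hg : Continuous g) (h0 : ∀ x, g x ≠ 0) :
    ∃ k : X → ℂ, Continuous k ∧ ∀ x, exp (k x) = g x := by
  have : ContractibleSpace (univ : Set X) :=
    (convex_univ (𝕜 := ℝ) (E := X)).contractibleSpace univ_nonempty
  have hsc : IsSimplyConnected (univ : Set X) :=
    inferInstanceAs (SimplyConnectedSpace (univ : Set X))
  obtain ⟨k, hk, hke⟩ := Complex.exists_continuousOn_eqOn_exp_comp hsc isOpen_univ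
    hg.continuousOn (by rintro ⟨x, -, hx⟩; exact h0 x hx)
  exact ⟨k, continuousOn_univ.1 hk, fun x => hke trivial⟩

/-- Two continuous logarithms of the same function differ by a constant period. -/
theorem exists_int_of_exp_eq {X : Type*} [TopologicalSpace X] {s : Set X} (hs : IsPreconnected s)
    {k₁ k₂ : X → ℂ} (h₁ : ContinuousOn k₁ s) (h₂ : ContinuousOn k₂ s)
    (h : ∀ x ∈ s, exp (k₁ x) = exp (k₂ x)) :
    ∃ n : ℤ, ∀ x ∈ s, k₁ x = k₂ x + n * (2 * π * I) := by
  rcases s.eq_empty_or_nonempty with rfl | ⟨x₀, hx₀⟩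
  · exact ⟨0, by simp⟩
  have hex : ∀ x ∈ s, ∃ n : ℤ, k₁ x = k₂ x + n * (2 * π * I) := fun x hx =>
    Complex.exp_eq_exp_iff_exists_int.1 (h x hx)
  choose! n hn using hex
  have hpi : (2 * π * I : ℂ) ≠ 0 := by simp [Real.pi_ne_zero]
  have hnc : ContinuousOn n s := by
    have h3 : ContinuousOn (fun x => ((k₁ x - k₂ x) / (2 * π * I)).re) s :=
      Complex.continuous_re.comp_continuousOn ((h₁.sub h₂).div_const _)
    have h4 : ContinuousOn (fun x => ((n x : ℤ) : ℝ)) s := by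
      refine h3.congr fun x hx => ?_
      beta_reduce
      rw [hn x hx, add_sub_cancel_left, mul_div_cancel_right₀ _ hpi]; simp
    exact (Int.isClosedEmbedding_coe_real.isInducing.continuousOn_iff).2 h4
  refine ⟨n x₀, fun x hx => ?_⟩
  rw [hn x hx, hs.constant hnc hx hx₀]

theorem apply_add_int_mul_eq {F : ℂ → ℂ} {c : ℂ}
    (h : ∀ u, F (u + 2 * π * I) = F u + c) (n : ℤ) (u : ℂ) :
    F (u + n * (2 * π * I)) = F u + n * c := by
  induction n using Int.induction_on with
  | zero => simp
  | succ i hi =>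
    have := h (u + i * (2 * π * I))
    push_cast at hi ⊢
    rw [show u + ((i : ℂ) + 1) * (2 * π * I) = u + i * (2 * π * I) + 2 * π * I by ring, this, hi]
    ring
  | pred i hi =>
    have := h (u + (-(i : ℂ) - 1) * (2 * π * I))
    push_cast at hi ⊢
    rw [show u + (-(i : ℂ) - 1) * (2 * π * I) + 2 * π * I = u + -(i : ℂ) * (2 * π * I) by ring,
      hi] at this
    linear_combination -this

theorem continuousOn_comp_log {F : ℂ → ℂ} (hF : Continuous F)
    (h : ∀ u, F (u + 2 * π * I) = F u) : ContinuousOn (fun w => F (log w)) {0}ᶜ := by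
  intro w hw
  refine ContinuousAt.continuousWithinAt ?_
  have hw : w ≠ 0 := hw
  by_cases hs : w ∈ slitPlane
  · exact hF.continuousAt.comp (continuousAt_clog hs)
  · have hs' : -w ∈ slitPlane := by
      rw [mem_slitPlane_iff] at hs ⊢
      push Not at hs
      refine Or.inl ?_
      rw [neg_re, neg_pos]
      rcases hs.1.lt_or_eq with h1 | h1
      · exact h1
      · exact absurd (Complex.ext h1 hs.2) hw
    have hc : ContinuousAt (fun w => F (log (-w) + π * I)) w :=
      hF.continuousAt.comp (((continuousAt_clog hs').comp continuous_neg.continuousAt).add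
        continuousAt_const)
    refine hc.congr ?_
    filter_upwards [isOpen_ne.mem_nhds hw] with y hy
    have : exp (log (-y) + π * I) = exp (log y) := by
      rw [exp_add, exp_log (neg_ne_zero.2 hy), exp_log hy, exp_pi_mul_I]; ring
    obtain ⟨n, hn⟩ := Complex.exp_eq_exp_iff_exists_int.1 this
    rw [hn, apply_add_int_mul_eq (F := F) (c := 0) (by simpa using h)]
    simp

/-- The increments of `Ψ` have a continuous logarithm relative to those of the identity. -/
def IncrementsHaveLog (Ψ : ℂ → ℂ) : Prop :=
  ∀ p, ∃ q : ℂ → ℂ, ContinuousOn q {p}ᶜ ∧ ∀ v, v ≠ p → Ψ v - Ψ p = (v - p) * exp (q v)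

theorem exists_increment_log (Ψ : ℂ ≃ₜ ℂ) :
    ∃ (L : ℂ × ℂ → ℂ) (d : ℤ), Continuous L ∧
      (∀ p u, exp (L (p, u)) = Ψ (p + exp u) - Ψ p) ∧
      ∀ p u, L (p, u + 2 * π * I) = L (p, u) + d * (2 * π * I) := by
  obtain ⟨L, hL, hLe⟩ := exists_continuous_log (X := ℂ × ℂ)
    (g := fun x => Ψ (x.1 + exp x.2) - Ψ x.1) (by fun_prop) (fun x => by
      rw [sub_ne_zero, Ψ.injective.ne_iff]; simp)
  obtain ⟨d, hd⟩ := exists_int_of_exp_eq (isPreconnected_univ (α := ℂ × ℂ))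
    (k₁ := fun x => L (x.1, x.2 + 2 * π * I)) (k₂ := L) (by fun_prop) (by fun_prop) (by
      rintro ⟨p, u⟩ -
      rw [hLe, hLe]
      simp [exp_add])
  exact ⟨L, d, hL, fun p u => hLe (p, u), fun p u => hd (p, u) trivial⟩

theorem incrementsHaveLog_of_period_one {Ψ : ℂ → ℂ} {L : ℂ × ℂ → ℂ} (hL : Continuous L)
    (hLe : ∀ p u, exp (L (p, u)) = Ψ (p + exp u) - Ψ p)
    (hd : ∀ p u, L (p, u + 2 * π * I) = L (p, u) + 2 * π * I) : IncrementsHaveLog Ψ := by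
  intro p
  refine ⟨fun v => L (p, log (v - p)) - log (v - p), ?_, fun v hv => ?_⟩
  · refine (continuousOn_comp_log (F := fun u => L (p, u) - u) (by fun_prop) (fun u => by
      rw [hd]; ring)).comp (f := fun v => v - p) (by fun_prop) ?_
    intro v hv
    exact sub_ne_zero.2 hv
  · have h1 : v - p ≠ 0 := sub_ne_zero.2 hv
    rw [exp_sub, hLe, exp_log h1, add_sub_cancel]
    field_simp

theorem incrementsHaveLog_or (Ψ : ℂ ≃ₜ ℂ) :
    IncrementsHaveLog Ψ ∨ IncrementsHaveLog (fun z => Ψ (starRingEnd ℂ z)) := by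
  have hpi : (2 * π * I : ℂ) ≠ 0 := by simp [Real.pi_ne_zero]
  obtain ⟨L, d, hL, hLe, hd⟩ := exists_increment_log Ψ
  obtain ⟨L', d', hL', hLe', hd'⟩ := exists_increment_log Ψ.symm
  have hunit : d * d' = 1 := by
    obtain ⟨n, hn⟩ := exists_int_of_exp_eq (isPreconnected_univ (α := ℂ))
      (k₁ := fun u => L' (Ψ 0, L (0, u))) (k₂ := id) (by fun_prop) (by fun_prop) (by
        intro u _
        simp [hLe', hLe])
    have h1 := hn (0 + 2 * π * I) trivial
    have h2 := hn 0 trivial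
    simp only [id] at h1 h2
    rw [hd, apply_add_int_mul_eq (F := fun u => L' (Ψ 0, u)) (hd' _), h2] at h1
    have h3 : ((d : ℂ) * d' - 1) * (2 * π * I) = 0 := by linear_combination h1
    have h4 := (mul_eq_zero.1 h3).resolve_right hpi
    exact_mod_cast sub_eq_zero.1 h4
  rcases Int.eq_one_or_neg_one_of_mul_eq_one hunit with rfl | rfl
  · exact Or.inl (incrementsHaveLog_of_period_one hL hLe (by simpa using hd))
  · refine Or.inr (incrementsHaveLog_of_period_one
      (L := fun x => L (starRingEnd ℂ x.1, starRingEnd ℂ x.2)) ?_ ?_ ?_)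
    · exact hL.comp (by fun_prop)
    · intro p u
      simp [hLe, exp_conj]
    · intro p u
      have := hd (starRingEnd ℂ p) (starRingEnd ℂ u - 2 * π * I)
      simp only [sub_add_cancel] at this
      rw [this]
      simp [sub_eq_add_neg, Complex.conj_ofNat]

theorem norm_mul_exp_mem_Icc {a q b : ℂ} (h : b = a * exp q) {θ : ℝ} (h0 : 0 ≤ θ) (h1 : θ ≤ 1) :
    min ‖a‖ ‖b‖ ≤ ‖a * exp (θ * q)‖ ∧ ‖a * exp (θ * q)‖ ≤ max ‖a‖ ‖b‖ := by
  have hb : ‖b‖ = ‖a‖ * Real.exp q.re := by rw [h, norm_mul, norm_exp]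
  have ht : ‖a * exp (θ * q)‖ = ‖a‖ * Real.exp (θ * q.re) := by
    rw [norm_mul, norm_exp, re_ofReal_mul]
  rw [hb, ht]
  have ha := norm_nonneg a
  rcases le_total 0 q.re with hq | hq
  · constructor
    · refine (min_le_left _ _).trans (le_mul_of_one_le_right ha (Real.one_le_exp (by positivity)))
    · refine le_trans ?_ (le_max_right _ _)
      gcongr
      nlinarith
  · constructor
    · refine (min_le_right _ _).trans ?_
      gcongr
      nlinarith
    · refine le_trans ?_ (le_max_left _ _)
      refine mul_le_of_le_one_right ha (Real.exp_le_one_iff.2 ?_)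
      nlinarith

/-- Straightening a map with increment logarithms to translations on disjoint regions. -/
theorem exists_straightening {Ψ : ℂ → ℂ} (hΨ : Continuous Ψ) (hlog : IncrementsHaveLog Ψ)
    {S : Set ℂ} {J : Type*} [Fintype J] (P : J → ℂ) (μ : J → ℂ → ℝ)
    (hμ : ∀ j, Continuous (μ j)) (hμ0 : ∀ j v, 0 ≤ μ j v) (hμ1 : ∀ j v, μ j v ≤ 1)
    (hdisj : ∀ i j v, μ i v ≠ 0 → μ j v ≠ 0 → i = j)
    (hmem : ∀ j v, μ j v ≠ 0 → Ψ v ∈ S → v = P j)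
    (havoid : ∀ j v y, μ j v ≠ 0 → Ψ v ∉ S →
      min ‖v - P j‖ ‖Ψ v - Ψ (P j)‖ ≤ ‖y - Ψ (P j)‖ →
      ‖y - Ψ (P j)‖ ≤ max ‖v - P j‖ ‖Ψ v - Ψ (P j)‖ → y ∉ S) :
    ∃ G : C(unitInterval × ℂ, ℂ), (∀ v, G (0, v) = Ψ v) ∧
      (∀ t v, Ψ v ∈ S → G (t, v) = Ψ v) ∧ (∀ t v, Ψ v ∉ S → G (t, v) ∉ S) ∧
      ∀ j v, μ j v = 1 → G (1, v) = v - P j + Ψ (P j) := by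
  classical
  choose q hqc hq using hlog
  let T : J → unitInterval × ℂ → ℂ := fun j x =>
    (x.2 - P j) * exp (((1 - x.1 * μ j x.2 : ℝ) : ℂ) * q (P j) x.2) -
      (x.2 - P j) * exp (q (P j) x.2)
  have hT0 : ∀ j t v, μ j v = 0 → T j (t, v) = 0 := by
    intro j t v h
    simp [T, h]
  have hTP : ∀ j t, T j (t, P j) = 0 := by simp [T]
  have hq' : ∀ j v, Ψ v - Ψ (P j) = (v - P j) * exp (q (P j) v) := by
    intro j v
    by_cases h : v = P j
    · simp [h]
    · exact hq _ _ h
  have hθ : ∀ j (t : unitInterval) v, 0 ≤ 1 - t * μ j v ∧ 1 - t * μ j v ≤ 1 := by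
    intro j t v
    have h1 := mul_le_one₀ t.2.2 (hμ0 j v) (hμ1 j v)
    have h2 := mul_nonneg t.2.1 (hμ0 j v)
    constructor <;> linarith
  have hTc : ∀ j, Continuous (T j) := by
    intro j
    rw [continuous_iff_continuousAt]
    rintro ⟨t, v⟩
    by_cases h : v = P j
    · subst h
      have hlim : Tendsto (fun x : unitInterval × ℂ =>
          max ‖x.2 - P j‖ ‖Ψ x.2 - Ψ (P j)‖ + ‖Ψ x.2 - Ψ (P j)‖) (𝓝 (t, P j)) (𝓝 0) := by
        have : Continuous (fun x : unitInterval × ℂ =>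
          max ‖x.2 - P j‖ ‖Ψ x.2 - Ψ (P j)‖ + ‖Ψ x.2 - Ψ (P j)‖) := by fun_prop
        simpa using this.tendsto (t, P j)
      rw [ContinuousAt, hTP]
      refine squeeze_zero_norm (fun x => ?_) hlim
      refine (norm_sub_le _ _).trans ?_
      rw [← hq' j x.2]
      gcongr
      exact (norm_mul_exp_mem_Icc (hq' j x.2) (hθ j x.1 x.2).1 (hθ j x.1 x.2).2).2
    · have hcq : ContinuousAt (fun x : unitInterval × ℂ => q (P j) x.2) (t, v) :=
        ContinuousAt.comp (f := fun x : unitInterval × ℂ => x.2) (x := (t, v))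
          ((hqc (P j)).continuousAt (isOpen_compl_singleton.mem_nhds h))
          continuous_snd.continuousAt
      have := hμ j
      have hc1 : ContinuousAt (fun x : unitInterval × ℂ => ((1 - x.1 * μ j x.2 : ℝ) : ℂ)) (t, v) :=
        Continuous.continuousAt (by fun_prop)
      have hc2 : ContinuousAt (fun x : unitInterval × ℂ => x.2 - P j) (t, v) :=
        Continuous.continuousAt (by fun_prop)
      exact (hc2.mul (hc1.mul hcq).cexp).sub (hc2.mul hcq.cexp)
  let G : C(unitInterval × ℂ, ℂ) := ⟨fun x => Ψ x.2 + ∑ j, T j x, by fun_prop⟩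
  have hGapp : ∀ t v, G (t, v) = Ψ v + ∑ j, T j (t, v) := fun t v => rfl
  have hG1 : ∀ j t v, μ j v ≠ 0 → G (t, v) - Ψ (P j) =
      (v - P j) * exp (((1 - t * μ j v : ℝ) : ℂ) * q (P j) v) := by
    intro j t v h
    rw [hGapp, Finset.sum_eq_single j]
    · have := hq' j v
      simp only [T]
      linear_combination this
    · intro i _ hij
      refine hT0 i t v ?_
      by_contra h2
      exact hij (hdisj i j v h2 h)
    · simp
  have hG0 : ∀ t v, (∀ j, μ j v = 0) → G (t, v) = Ψ v := by
    intro t v h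
    rw [hGapp, Finset.sum_eq_zero (fun j _ => hT0 j t v (h j)), add_zero]
  refine ⟨G, ?_, ?_, ?_, ?_⟩
  · intro v
    simp [hGapp, T]
  · intro t v hv
    rcases Classical.em (∀ j, μ j v = 0) with h | h
    · exact hG0 t v h
    · push Not at h
      obtain ⟨j, hj⟩ := h
      have h1 := hG1 j t v hj
      have h2 := hmem j v hj hv
      subst h2
      rw [sub_self, zero_mul, sub_eq_zero] at h1
      exact h1
  · intro t v hv
    rcases Classical.em (∀ j, μ j v = 0) with h | h
    · rw [hG0 t v h]; exact hv
    · push Not at h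
      obtain ⟨j, hj⟩ := h
      have := norm_mul_exp_mem_Icc (hq' j v) (hθ j t v).1 (hθ j t v).2
      rw [← hG1 j t v hj] at this
      exact havoid j v _ hj hv this.1 this.2
  · intro j v h
    have := hG1 j 1 v (by rw [h]; exact one_ne_zero)
    simp only [h, Icc.coe_one, mul_one, sub_self, ofReal_zero, zero_mul, exp_zero] at this
    linear_combination this

/-- Smoothing a map that is locally a translation off a compact set. -/
theorem exists_smoothing {Ψ : ℂ → ℂ} (hΨ : Continuous Ψ) {S : Set ℂ} (hS : IsClosed S)
    {K : Set ℂ} (hK : IsCompact K) (hKS : ∀ v ∈ K, Ψ v ∉ S) {r₀ : ℝ} (hr₀ : 0 < r₀)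
    (hD : ∀ v ∉ K, ∀ y ∈ ball v r₀, Ψ y - y = Ψ v - v) :
    ∃ χ : ℂ → ℂ, ContDiff ℝ 1 χ ∧ (∀ v ∉ K, χ v = Ψ v) ∧
      ∀ v ∈ K, ∀ t : ℝ, 0 ≤ t → t ≤ 1 → Ψ v + t * (χ v - Ψ v) ∉ S := by
  obtain ⟨ε, hε, hεS⟩ : ∃ ε > 0, ∀ v ∈ K, ∀ y, dist y (Ψ v) ≤ ε → y ∉ S := by
    have hd : Disjoint (Ψ '' K) S := by
      rw [Set.disjoint_left]
      rintro _ ⟨v, hv, rfl⟩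
      exact hKS v hv
    obtain ⟨ε, hε, h⟩ := hd.exists_cthickenings (hK.image hΨ) hS
    refine ⟨ε, hε, fun v hv y hy hyS => Set.disjoint_left.1 h ?_ (self_subset_cthickening _ hyS)⟩
    exact mem_cthickening_of_dist_le _ _ _ _ (mem_image_of_mem Ψ hv) hy
  let D : ℂ → ℂ := fun v => Ψ v - v
  have hDc : Continuous D := by fun_prop
  have hunif := hK.uniformContinuousAt_of_continuousAt D (fun a _ => hDc.continuousAt)
    (Metric.dist_mem_uniformity hε)
  obtain ⟨r₁, hr₁, h₁⟩ := Metric.mem_uniformity_dist.1 hunif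
  have hr : 0 < min r₀ r₁ := lt_min hr₀ hr₁
  let b : ContDiffBump (0 : ℂ) := ⟨min r₀ r₁ / 2, min r₀ r₁, by positivity, by linarith⟩
  let M : ℂ → ℂ :=
    MeasureTheory.convolution (b.normed volume) D (ContinuousLinearMap.lsmul ℝ ℝ) volume
  have hM : ContDiff ℝ 1 M :=
    b.hasCompactSupport_normed.contDiff_convolution_left _ b.contDiff_normed
      hDc.locallyIntegrable
  refine ⟨fun v => v + M v, contDiff_id.add hM, fun v hv => ?_, fun v hv t h0 h1 => ?_⟩
  · have : M v = D v := b.normed_convolution_eq_right fun y hy =>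
      hD v hv y (ball_subset_ball (min_le_left _ _) hy)
    simp [this, D]
  · refine hεS v hv _ ?_
    have : dist (M v) (D v) ≤ ε := b.dist_normed_convolution_le hDc.aestronglyMeasurable
      fun y hy => by
        have := h₁ (a := v) (b := y)
          (by rw [dist_comm]; exact lt_of_lt_of_le hy (min_le_right _ _)) hv
        rw [dist_comm]; exact (show dist (D v) (D y) < ε from this).le
    rw [dist_eq_norm] at this ⊢
    have h2 : Ψ v + t * (v + M v - Ψ v) - Ψ v = t * (M v - D v) := by simp only [D]; ring
    rw [h2, norm_mul, norm_real, Real.norm_of_nonneg h0]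
    nlinarith [norm_nonneg (M v - D v)]

theorem eventually_cocompact_iff {P : ℂ → Prop} :
    (∀ᶠ v in cocompact ℂ, P v) ↔ ∃ r : ℝ, ∀ v, r < ‖v‖ → P v := by
  have h := mem_cocompact_iff_closedBall_compl_subset (s := {v | P v}) (0 : ℂ)
  refine Iff.trans h (exists_congr fun r => ?_)
  simp only [subset_def, mem_compl_iff, mem_closedBall, dist_zero_right, not_le]
  rfl

/-- `χ` is a smooth model of `Ψ` relative to `S`: it is homotopic to `Ψ` relative to `S`, and on
the open set `V`, which contains `Ψ⁻¹ S` and a neighbourhood of infinity, it is injective and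
locally a translation. -/
structure IsModelMap (Ψ : ℂ → ℂ) (S : Set ℂ) (G : C(unitInterval × ℂ, ℂ)) (χ : ℂ → ℂ)
    (V : Set ℂ) (c : ℂ) (ρ : ℝ) : Prop where
  zero : ∀ v, G (0, v) = Ψ v
  one : ∀ v, G (1, v) = χ v
  of_mem : ∀ t v, Ψ v ∈ S → G (t, v) = Ψ v
  of_notMem : ∀ t v, Ψ v ∉ S → G (t, v) ∉ S
  contDiff : ContDiff ℝ 1 χ
  isOpen : IsOpen V
  mem_of_mem : ∀ v, Ψ v ∈ S → v ∈ V
  inj : ∀ v ∈ V, ∀ v', χ v' = χ v → v' = v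
  translation : ∀ v ∈ V, ∃ a, ∀ᶠ y in 𝓝 v, χ y = y + a
  infty : ∀ v, ρ < ‖v‖ → v ∈ V ∧ χ v = v + c

theorem exists_radius_near {Ψ : ℂ ≃ₜ ℂ} {S : Set ℂ} (hS : S.Finite) :
    ∃ δ : ℝ, 0 < δ ∧ δ ≤ 1 ∧
      (∀ p, Ψ p ∈ S → ∀ v, ‖v - p‖ < δ → ∀ s ∈ S, s ≠ Ψ p →
        ‖v - p‖ < ‖s - Ψ p‖ ∧ ‖Ψ v - Ψ p‖ < ‖s - Ψ p‖) ∧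
      ∀ p p', Ψ p ∈ S → Ψ p' ∈ S → p ≠ p' → 2 * δ ≤ ‖p - p'‖ ∧ 2 * δ ≤ ‖Ψ p - Ψ p'‖ := by
  have hS' : (Ψ ⁻¹' S).Finite := hS.preimage Ψ.injective.injOn
  have h1 : ∀ᶠ δ : ℝ in 𝓝[>] 0, 0 < δ := eventually_mem_nhdsWithin
  have hle : ∀ a : ℝ, 0 < a → ∀ᶠ δ : ℝ in 𝓝[>] 0, δ ≤ a := fun a ha =>
    eventually_nhdsWithin_of_eventually_nhds (eventually_le_nhds ha)
  have h3 : ∀ᶠ δ : ℝ in 𝓝[>] 0, ∀ p ∈ Ψ ⁻¹' S, ∀ s ∈ S, s ≠ Ψ p → ∀ v, ‖v - p‖ < δ →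
      ‖v - p‖ < ‖s - Ψ p‖ ∧ ‖Ψ v - Ψ p‖ < ‖s - Ψ p‖ := by
    rw [eventually_all_finite hS']
    intro p hp
    rw [eventually_all_finite hS]
    intro s hs
    by_cases hsp : s = Ψ p
    · simp [hsp]
    have h0 : 0 < ‖s - Ψ p‖ := norm_pos_iff.2 (sub_ne_zero.2 hsp)
    have hev : ∀ᶠ v in 𝓝 p, ‖v - p‖ < ‖s - Ψ p‖ ∧ ‖Ψ v - Ψ p‖ < ‖s - Ψ p‖ := by
      have c1 : Continuous fun v : ℂ => ‖v - p‖ := by fun_prop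
      have c2 : Continuous fun v : ℂ => ‖Ψ v - Ψ p‖ := by fun_prop
      exact (c1.continuousAt.eventually_lt continuousAt_const (by simpa using h0)).and
        (c2.continuousAt.eventually_lt continuousAt_const (by simpa using h0))
    obtain ⟨a, ha, hav⟩ := Metric.eventually_nhds_iff.1 hev
    filter_upwards [hle a ha] with δ hδ _ v hv
    exact hav (by rw [dist_eq_norm]; linarith)
  have h4 : ∀ᶠ δ : ℝ in 𝓝[>] 0, ∀ p ∈ Ψ ⁻¹' S, ∀ p' ∈ Ψ ⁻¹' S, p ≠ p' →
      2 * δ ≤ ‖p - p'‖ ∧ 2 * δ ≤ ‖Ψ p - Ψ p'‖ := by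
    rw [eventually_all_finite hS']
    intro p hp
    rw [eventually_all_finite hS']
    intro p' hp'
    by_cases hpp : p = p'
    · simp [hpp]
    have a1 : 0 < ‖p - p'‖ := norm_pos_iff.2 (sub_ne_zero.2 hpp)
    have a2 : 0 < ‖Ψ p - Ψ p'‖ := norm_pos_iff.2 (sub_ne_zero.2 (Ψ.injective.ne hpp))
    filter_upwards [hle _ (half_pos a1), hle _ (half_pos a2)] with δ d1 d2 _
    constructor <;> linarith
  obtain ⟨δ, d1, d2, d3, d4⟩ := (h1.and ((hle 1 one_pos).and (h3.and h4))).exists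
  exact ⟨δ, d1, d2, fun p hp v hv s hs hsp => d3 p hp s hs hsp v hv,
    fun p p' hp hp' hpp => d4 p hp p' hp' hpp⟩

theorem exists_radius_far {Ψ : ℂ ≃ₜ ℂ} {S : Set ℂ} (hS : S.Finite) (p₀ : ℂ) :
    ∃ R : ℝ, (∀ p, Ψ p ∈ S → ‖p‖ + 1 ≤ R) ∧
      ∀ v, R < ‖v‖ → ∀ s ∈ S, ‖s - Ψ p₀‖ + 1 < ‖v - p₀‖ ∧ ‖s - Ψ p₀‖ < ‖Ψ v - Ψ p₀‖ := by
  have hS' : (Ψ ⁻¹' S).Finite := hS.preimage Ψ.injective.injOn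
  obtain ⟨B, hB⟩ := hS.isBounded.exists_norm_le
  obtain ⟨B', hB'⟩ := hS'.isBounded.exists_norm_le
  have hev : ∀ᶠ v in cocompact ℂ, B + ‖Ψ p₀‖ + ‖Ψ p₀‖ < ‖Ψ v‖ :=
    (tendsto_norm_cocompact_atTop.comp Ψ.isClosedEmbedding.tendsto_cocompact).eventually_gt_atTop _
  obtain ⟨r, hr⟩ := eventually_cocompact_iff.1 hev
  refine ⟨max r (max (B' + 1) (B + ‖Ψ p₀‖ + 1 + ‖p₀‖)), fun p hp => ?_, fun v hv s hs => ?_⟩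
  · have := hB' p hp
    exact le_trans (by linarith) (le_trans (le_max_left _ _) (le_max_right _ _))
  · simp only [max_lt_iff] at hv
    have h1 := hr v hv.1
    have h2 := hB s hs
    have h3 := norm_sub_le s (Ψ p₀)
    have h4 := norm_sub_norm_le v p₀
    have h5 := norm_sub_norm_le (Ψ v) (Ψ p₀)
    constructor <;> linarith [hv.2.2]

theorem exists_model_map {Ψ : ℂ ≃ₜ ℂ} (hlog : IncrementsHaveLog Ψ) {S : Set ℂ} (hS : S.Finite)
    (hne : S.Nonempty) : ∃ G χ V c ρ, IsModelMap Ψ S G χ V c ρ := by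
  classical
  obtain ⟨s₀, hs₀⟩ := hne
  obtain ⟨p₀, rfl⟩ := Ψ.surjective s₀
  have hS' : (Ψ ⁻¹' S).Finite := hS.preimage Ψ.injective.injOn
  obtain ⟨δ, hδ, hδ1, hA, hB⟩ := exists_radius_near (Ψ := Ψ) hS
  obtain ⟨R, hC, hD⟩ := exists_radius_far (Ψ := Ψ) hS p₀
  let S' := Ψ ⁻¹' S
  have : Fintype S' := hS'.fintype
  let P : Option S' → ℂ := fun j => j.elim p₀ Subtype.val
  have hPS : ∀ j, Ψ (P j) ∈ S := by
    rintro (_ | ⟨p, hp⟩)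
    · exact hs₀
    · exact hp
  let μ : Option S' → ℂ → ℝ := fun j v =>
    j.elim (max 0 (min 1 (‖v‖ - R))) fun p => max 0 (min 1 (2 - 2 * ‖v - p‖ / δ))
  let N : Option S' → ℂ → Prop := fun j v => j.elim (R + 2 < ‖v‖) fun p => ‖v - p‖ < δ / 4
  have hμn : ∀ v, μ none v ≠ 0 → R < ‖v‖ := by
    intro v h
    by_contra! h2
    exact h (max_eq_left ((min_le_right _ _).trans (by linarith)))
  have hμs : ∀ (p : S') v, μ (some p) v ≠ 0 → ‖v - p‖ < δ := by
    intro p v h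
    by_contra! h2
    refine h (max_eq_left ((min_le_right _ _).trans ?_))
    have : 1 ≤ ‖v - p‖ / δ := (one_le_div hδ).2 h2
    rw [mul_div_assoc]
    linarith
  have hμ1 : ∀ j v, N j v → ∀ y ∈ ball v (δ / 4), μ j y = 1 := by
    rintro (_ | p) v h y hy
    · have h1 : R + 2 < ‖v‖ := h
      have h2 := norm_sub_norm_le v y
      rw [mem_ball, dist_comm, dist_eq_norm] at hy
      have : (1 : ℝ) ≤ ‖y‖ - R := by linarith
      change max 0 (min 1 (‖y‖ - R)) = 1
      rw [min_eq_left this, max_eq_right zero_le_one]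
    · have h1 : ‖v - p‖ < δ / 4 := h
      rw [mem_ball, dist_eq_norm] at hy
      have h2 := norm_sub_le_norm_sub_add_norm_sub y v p
      have h3 : ‖y - p‖ / δ ≤ 1 / 2 := by
        rw [div_le_iff₀ hδ]; linarith
      have : (1 : ℝ) ≤ 2 - 2 * ‖y - p‖ / δ := by rw [mul_div_assoc]; linarith
      change max 0 (min 1 (2 - 2 * ‖y - p‖ / δ)) = 1
      rw [min_eq_left this, max_eq_right zero_le_one]
  obtain ⟨G₁, hG0, hGS, hGnS, hG1⟩ := exists_straightening Ψ.continuous hlog (S := S) P μ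
    (by rintro (_ | p) <;> · simp only [μ, Option.elim]; fun_prop)
    (by rintro (_ | p) v <;> exact le_max_left _ _)
    (by rintro (_ | p) v <;> exact max_le zero_le_one (min_le_left _ _))
    (by
      rintro (_ | p) (_ | p') v h1 h2
      · rfl
      · have a1 := hμn v h1
        have a2 := hμs p' v h2
        have a3 := hC p' p'.2
        have a4 := norm_sub_norm_le v p'
        linarith
      · have a1 := hμn v h2
        have a2 := hμs p v h1
        have a3 := hC p p.2
        have a4 := norm_sub_norm_le v p
        linarith
      · by_contra hne
        have a1 := hμs p v h1
        have a2 := hμs p' v h2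
        have a3 := (hB p p' p.2 p'.2 (fun h => hne (congrArg some (Subtype.ext h)))).1
        have a4 := norm_sub_le_norm_sub_add_norm_sub (p : ℂ) v p'
        rw [norm_sub_rev (p : ℂ) v] at a4
        linarith)
    (by
      rintro (_ | p) v h hv
      · exact absurd (hD v (hμn v h) _ hv).2 (lt_irrefl _)
      · by_contra hne
        exact absurd (hA p p.2 v (hμs p v h) _ hv (Ψ.injective.ne hne)).2 (lt_irrefl _))
    (by
      rintro (_ | p) v y h hv h1 h2 hy
      · have a := hD v (hμn v h) y hy
        exact absurd h1 (not_le.2 (lt_min ((lt_add_one _).trans a.1) a.2))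
      · by_cases hyp : y = Ψ p
        · have hy0 : ‖y - Ψ (P (some p))‖ = 0 := by rw [hyp]; exact norm_eq_zero.2 (sub_self _)
          rw [hy0] at h1
          have hvp : v ≠ p := by rintro rfl; exact hv p.2
          exact absurd h1 (not_le.2 (lt_min (norm_pos_iff.2 (sub_ne_zero.2 hvp))
            (norm_pos_iff.2 (sub_ne_zero.2 (Ψ.injective.ne hvp)))))
        · have a := hA p p.2 v (hμs p v h) y hy hyp
          exact absurd h2 (not_le.2 (max_lt a.1 a.2)))
  let K : Set ℂ := {v | ∀ j, ¬ N j v}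
  have hNo : ∀ j, IsOpen {v | N j v} := by
    rintro (_ | p)
    · exact isOpen_lt continuous_const continuous_norm
    · exact isOpen_lt (by fun_prop) continuous_const
  have hKc : IsClosed K := by
    have : K = ⋂ j, {v | N j v}ᶜ := by ext; simp [K]
    rw [this]
    exact isClosed_iInter fun j => (hNo j).isClosed_compl
  have hK : IsCompact K := by
    refine (isCompact_closedBall (0 : ℂ) (R + 2)).of_isClosed_subset hKc fun v hv => ?_
    rw [mem_closedBall, dist_zero_right]
    exact not_lt.1 (hv none)
  have hKS : ∀ v ∈ K, Ψ v ∉ S := fun v hv h => by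
    refine hv (some ⟨v, h⟩) ?_
    change ‖v - v‖ < δ / 4
    simpa using hδ
  have hN : ∀ j v, N j v → ∀ y ∈ ball v (δ / 4), G₁ (1, y) = y - P j + Ψ (P j) :=
    fun j v h y hy => hG1 j y (hμ1 j v h y hy)
  have hN' : ∀ j v, N j v → G₁ (1, v) = v - P j + Ψ (P j) :=
    fun j v h => hN j v h v (mem_ball_self (by positivity))
  have hNK : ∀ v, v ∉ K → ∃ j, N j v := fun v hv => by
    by_contra! h
    exact hv h
  obtain ⟨χ, hχ, hχK, hχS⟩ := exists_smoothing (Ψ := fun v => G₁ (1, v)) (by fun_prop)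
    hS.isClosed hK (fun v hv => hGnS 1 v (hKS v hv)) (r₀ := δ / 4) (by positivity) (by
      intro v hv y hy
      obtain ⟨j, hj⟩ := hNK v hv
      rw [hN j v hj y hy, hN' j v hj]
      ring)
  have hχN : ∀ j v, N j v → χ v = v - P j + Ψ (P j) := fun j v h => by
    rw [hχK v (fun hv => hv j h), hN' j v h]
  have hinj : ∀ i j v v', N i v → N j v' → χ v' = χ v → v' = v := by
    have key : ∀ (p : S') (v v' : ℂ), R + 2 < ‖v‖ → ‖v' - p‖ < δ / 4 →
        v' - p + Ψ p ≠ v - p₀ + Ψ p₀ := by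
      intro p v v' h1 h2 h
      have a := (hD v (by linarith) _ p.2).1
      have b : v - p₀ = (v' - p) + (Ψ p - Ψ p₀) := by linear_combination -h
      have c := norm_add_le (v' - (p : ℂ)) (Ψ p - Ψ p₀)
      rw [← b] at c
      linarith
    rintro (_ | p) (_ | p') v v' h1 h2 h
    all_goals rw [hχN _ _ h1, hχN _ _ h2] at h
    · exact sub_left_injective (add_left_injective _ h)
    · exact absurd h (key p' v v' h1 h2)
    · exact absurd h.symm (key p v' v h2 h1)
    · have hpp : p = p' := by
        by_contra hne
        have a := (hB p p' p.2 p'.2 (fun h => hne (Subtype.ext h))).2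
        have b : Ψ p - Ψ p' = (v' - p') - (v - p) := by
          have : v' - p' + Ψ p' = v - p + Ψ p := h
          linear_combination -this
        have c := norm_sub_le (v' - (p' : ℂ)) (v - p)
        rw [← b] at c
        have d1 : ‖v - p‖ < δ / 4 := h1
        have d2 : ‖v' - p'‖ < δ / 4 := h2
        linarith
      subst hpp
      exact sub_left_injective (add_left_injective _ h)
  let G : C(unitInterval × ℂ, ℂ) := ⟨fun x => G₁ (projIcc 0 1 zero_le_one (2 * (x.1 : ℝ)), x.2) +
    ((max 0 (2 * x.1 - 1) : ℝ) : ℂ) * (χ x.2 - G₁ (1, x.2)), by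
      have := hχ.continuous
      fun_prop⟩
  have hGapp : ∀ t v, G (t, v) = G₁ (projIcc 0 1 zero_le_one (2 * (t : ℝ)), v) +
    ((max 0 (2 * t - 1) : ℝ) : ℂ) * (χ v - G₁ (1, v)) := fun t v => rfl
  have hGK : ∀ t, ∀ v ∉ K, G (t, v) = G₁ (projIcc 0 1 zero_le_one (2 * (t : ℝ)), v) := by
    intro t v hv
    rw [hGapp, hχK v hv, sub_self, mul_zero, add_zero]
  let V : Set ℂ := Kᶜ ∩ χ ⁻¹' (χ '' K)ᶜ
  have hχim : IsCompact (χ '' K) := hK.image hχ.continuous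
  have hGnS' : ∀ t v, Ψ v ∉ S → G (t, v) ∉ S := by
    intro t v hv
    by_cases hvK : v ∈ K
    · rcases le_total (2 * (t : ℝ)) 1 with ht | ht
      · rw [hGapp, max_eq_left (by linarith), ofReal_zero, zero_mul, add_zero]
        exact hGnS _ v hv
      · rw [hGapp, max_eq_right (by linarith), projIcc_of_right_le _ ht]
        exact hχS v hvK _ (by linarith) (by linarith [t.2.2])
    · rw [hGK t v hvK]
      exact hGnS _ v hv
  have hone : ∀ v, G (1, v) = χ v := by
    intro v
    rw [hGapp, projIcc_of_right_le _ (by norm_num)]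
    norm_num
  have hGS' : ∀ t v, Ψ v ∈ S → G (t, v) = Ψ v := by
    intro t v hv
    rw [hGK t v (fun h => hKS v h hv)]
    exact hGS _ v hv
  obtain ⟨B, hBχ⟩ := hχim.isBounded.exists_norm_le
  refine ⟨G, χ, V, Ψ p₀ - p₀, max (R + 2) (B + ‖Ψ p₀ - p₀‖), ?_, hone, hGS', hGnS', hχ, ?_, ?_,
    ?_, ?_, ?_⟩
  · intro v
    rw [hGapp, projIcc_of_le_left _ (by norm_num), ← hG0]
    norm_num
  · exact hKc.isOpen_compl.inter (hχim.isClosed.isOpen_compl.preimage hχ.continuous)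
  · intro v hv
    refine ⟨fun h => hKS v h hv, ?_⟩
    rintro ⟨y, hy, hyv⟩
    have h1 := hGnS' 1 y (hKS y hy)
    rw [hone, hyv, ← hone, hGS' 1 v hv] at h1
    exact h1 hv
  · rintro v ⟨hv, hv2⟩ v' h
    have hv' : v' ∉ K := fun h' => hv2 ⟨v', h', h⟩
    obtain ⟨i, hi⟩ := hNK v hv
    obtain ⟨j, hj⟩ := hNK v' hv'
    exact hinj i j v v' hi hj h
  · rintro v ⟨hv, -⟩
    obtain ⟨j, hj⟩ := hNK v hv
    refine ⟨Ψ (P j) - P j, ?_⟩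
    filter_upwards [(hNo j).mem_nhds hj] with y hy
    rw [hχN j y hy]
    ring
  · intro v hv
    rw [max_lt_iff] at hv
    have hj : N none v := hv.1
    have hχv : χ v = v + (Ψ p₀ - p₀) := by
      rw [hχN none v hj]
      simp only [P, Option.elim]
      ring
    refine ⟨⟨fun h => h none hj, fun h => ?_⟩, hχv⟩
    have h1 := hBχ _ h
    rw [hχv] at h1
    have h2 := norm_sub_le_norm_add v (Ψ p₀ - p₀)
    linarith [hv.2]

theorem IsModelMap.mem_iff {Ψ : ℂ → ℂ} {S : Set ℂ} {G : C(unitInterval × ℂ, ℂ)} {χ : ℂ → ℂ}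
    {V : Set ℂ} {c : ℂ} {ρ : ℝ} (hM : IsModelMap Ψ S G χ V c ρ) (t : unitInterval) (v : ℂ) :
    G (t, v) ∈ S ↔ Ψ v ∈ S := by
  constructor
  · intro h
    by_contra h2
    exact hM.of_notMem t v h2 h
  · intro h
    rw [hM.of_mem t v h]
    exact h

theorem IsModelMap.tendsto {Ψ : ℂ → ℂ} {S : Set ℂ} {G : C(unitInterval × ℂ, ℂ)} {χ : ℂ → ℂ}
    {V : Set ℂ} {c : ℂ} {ρ : ℝ} (hM : IsModelMap Ψ S G χ V c ρ) :
    Tendsto χ (cocompact ℂ) (cocompact ℂ) := by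
  have h1 : Tendsto (fun v => v + c) (cocompact ℂ) (cocompact ℂ) :=
    (Homeomorph.addRight c).isClosedEmbedding.tendsto_cocompact
  refine h1.congr' ?_
  exact eventually_cocompact_iff.2 ⟨ρ, fun v hv => (hM.infty v hv).2.symm⟩

/-- The comparison map `h` between the domains of `g` and `f`. -/
theorem exists_comparison_map {f g : ℂ → ℂ} (hf : Differentiable ℂ f)
    (hnc : ¬ ∃ c, ∀ z, f z = c) (hg : Continuous g) {S : Set ℂ} (hS : S.Finite)
    (hfS : singularSet f ⊆ S) {Φ Ψ : ℂ ≃ₜ ℂ} (hfg : ∀ w, f (Φ w) = Ψ (g w))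
    {G : C(unitInterval × ℂ, ℂ)} {χ : ℂ → ℂ} {V : Set ℂ} {c : ℂ} {ρ : ℝ}
    (hM : IsModelMap Ψ S G χ V c ρ) :
    ∃ h : ℂ → ℂ, Continuous h ∧ (∀ w, f (h w) = χ (g w)) ∧
      (∀ w w', g w = g w' → h w = h w' → w = w') ∧
      (∀ z v, f z = χ v → ∃ w, g w = v ∧ h w = z) ∧
      Tendsto h (cocompact ℂ) (cocompact ℂ) := by
  obtain ⟨L, hLf, hL0, hLS⟩ := exists_lift_homotopy hf hnc hS hfS
    (H := ⟨fun x : unitInterval × ℂ => G (x.1, g x.2), by fun_prop⟩) (l := ⟨Φ, Φ.continuous⟩)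
    (fun w => by simp [hfg, hM.zero])
    (fun w h t => by
      have h' : G (0, g w) ∉ S := h
      change G (t, g w) ∉ S
      rwa [hM.mem_iff] at h' ⊢)
    (fun w h t => by
      have h' : G (0, g w) ∈ S := h
      change G (t, g w) = G (0, g w)
      rw [hM.mem_iff] at h'
      rw [hM.of_mem t _ h', hM.of_mem 0 _ h'])
  replace hLf : ∀ t w, f (L (t, w)) = G (t, g w) := fun t w => hLf (t, w)
  replace hL0 : ∀ w, L (0, w) = Φ w := hL0
  replace hLS : ∀ w, Ψ (g w) ∈ S → ∀ t, L (t, w) = Φ w := fun w h t =>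
    hLS w ((hM.mem_iff 0 (g w)).2 h) t
  let P : Set (ℂ × ℂ) := {x | f x.1 = χ x.2}
  obtain ⟨B, hBf, hB0, hBS⟩ := exists_lift_homotopy hf hnc hS hfS
    (H := ⟨fun x : unitInterval × P => G (unitInterval.symm x.1, x.2.1.2), by fun_prop⟩)
    (l := ⟨fun x : P => x.1.1, by fun_prop⟩)
    (fun x : P => by
      change f x.1.1 = G (unitInterval.symm 0, x.1.2)
      rw [unitInterval.symm_zero, hM.one, x.2])
    (fun x h t => by
      have h' : G (unitInterval.symm 0, x.1.2) ∉ S := h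
      change G (unitInterval.symm t, x.1.2) ∉ S
      rwa [hM.mem_iff] at h' ⊢)
    (fun x h t => by
      have h' : G (unitInterval.symm 0, x.1.2) ∈ S := h
      change G (unitInterval.symm t, x.1.2) = G (unitInterval.symm 0, x.1.2)
      rw [hM.mem_iff] at h'
      rw [hM.of_mem _ _ h', hM.of_mem _ _ h'])
  replace hBf : ∀ t (x : P), f (B (t, x)) = G (unitInterval.symm t, x.1.2) :=
    fun t x => hBf (t, x)
  replace hB0 : ∀ x : P, B (0, x) = x.1.1 := hB0
  replace hBS : ∀ x : P, Ψ x.1.2 ∈ S → ∀ t, B (t, x) = x.1.1 := fun x h t =>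
    hBS x ((hM.mem_iff _ _).2 h) t
  let W : P → ℂ := fun x => Φ.symm (B (1, x))
  have hWc : Continuous W := by fun_prop
  have hWg : ∀ x : P, g (W x) = x.1.2 := by
    intro x
    apply Ψ.injective
    rw [← hfg, Homeomorph.apply_symm_apply, hBf, unitInterval.symm_one, hM.zero]
  have hWh : ∀ x : P, L (1, W x) = x.1.1 := by
    intro x
    by_cases hx : Ψ x.1.2 ∈ S
    · rw [hLS _ (by rwa [hWg]), Homeomorph.apply_symm_apply, hBS x hx]
    · have := eq_of_lift_eq hf.continuous hfS (Γ₁ := fun t => L (t, W x))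
        (Γ₂ := fun t => B (unitInterval.symm t, x)) (by fun_prop) (by fun_prop)
        (fun t => by rw [hLf, hBf, unitInterval.symm_symm, hWg])
        (fun t => by rwa [hLf, hM.mem_iff, hWg]) (t₀ := 0)
        (by simp [hL0, W]) 1
      simp only [unitInterval.symm_one] at this
      rw [this, hB0]
  have hLh : ∀ w, f (L (1, w)) = χ (g w) := fun w => by rw [hLf, hM.one]
  have hinj : ∀ w w', g w = g w' → L (1, w) = L (1, w') → w = w' := by
    intro w w' h1 h2
    apply Φ.injective
    by_cases hx : Ψ (g w) ∈ S
    · rw [← hLS w hx 1, h2, hLS w' (by rwa [← h1])]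
    · have := eq_of_lift_eq hf.continuous hfS (Γ₁ := fun t => L (t, w))
        (Γ₂ := fun t => L (t, w')) (by fun_prop) (by fun_prop)
        (fun t => by rw [hLf, hLf, h1])
        (fun t => by rwa [hLf, hM.mem_iff]) (t₀ := 1) h2 0
      simpa only [hL0] using this
  refine ⟨fun w => L (1, w), by fun_prop, hLh, hinj,
    fun z v h => ⟨W ⟨(z, v), h⟩, hWg _, hWh _⟩, ?_⟩
  have hret : ∀ w, W ⟨(L (1, w), g w), hLh w⟩ = w := fun w =>
    hinj _ _ (hWg _) (hWh _)
  refine hasBasis_cocompact.tendsto_right_iff.2 fun K hK => ?_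
  have hχ := hM.contDiff.continuous
  have hK2 : IsCompact (χ ⁻¹' (f '' K)) :=
    (isProperMap_iff_tendsto_cocompact.2 ⟨hχ, hM.tendsto⟩).isCompact_preimage
      (hK.image hf.continuous)
  have hQ : IsCompact {x : P | x.1.1 ∈ K} := by
    rw [Subtype.isCompact_iff]
    refine (hK.prod hK2).of_isClosed_subset (?_ : IsClosed _) ?_
    · have : Subtype.val '' {x : P | x.1.1 ∈ K} = {x : ℂ × ℂ | f x.1 = χ x.2} ∩ Prod.fst ⁻¹' K := by
        ext x
        constructor
        · rintro ⟨y, hy, rfl⟩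
          exact ⟨y.2, hy⟩
        · rintro ⟨h1, h2⟩
          exact ⟨⟨x, h1⟩, h2, rfl⟩
      rw [this]
      have hfc := hf.continuous
      exact (isClosed_eq (by fun_prop) (by fun_prop)).inter (hK.isClosed.preimage continuous_fst)
    · rintro _ ⟨y, hy, rfl⟩
      exact ⟨hy, ⟨_, hy, y.2⟩⟩
  filter_upwards [(hQ.image hWc).compl_mem_cocompact] with w hw hwK
  exact hw ⟨_, hwK, hret w⟩

theorem deriv_ne_zero_of_injOn {f : ℂ → ℂ} {U : Set ℂ} (hU : IsOpen U)
    (hf : DifferentiableOn ℂ f U) (hinj : InjOn f U) {z : ℂ} (hz : z ∈ U) : deriv f z ≠ 0 := by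
  have hfa : AnalyticOnNhd ℂ f U := hf.analyticOnNhd hU
  have hne : ∀ᶠ y in 𝓝[≠] z, deriv f y ≠ 0 := by
    refine (hfa z hz).deriv.eventually_eq_zero_or_eventually_ne_zero.resolve_left fun h => ?_
    obtain ⟨r, hr, hr'⟩ := Metric.eventually_nhds_iff_ball.1 (h.and (hU.mem_nhds hz))
    have hd : DifferentiableOn ℂ f (ball z r) := hf.mono fun y hy => (hr' y hy).2
    have hzr : z + (r / 2 : ℝ) ∈ ball z r := by
      rw [mem_ball, dist_eq_norm, add_sub_cancel_left, norm_real, Real.norm_eq_abs,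
        abs_of_pos (by positivity)]
      linarith
    have := (convex_ball z r).is_const_of_fderivWithin_eq_zero (𝕜 := ℂ) hd (fun y hy => by
      rw [fderivWithin_of_isOpen isOpen_ball hy]
      ext
      simpa using (hr' y hy).1) (mem_ball_self hr) hzr
    have h2 := hinj hz (hr' _ hzr).2 this
    rw [left_eq_add, ofReal_eq_zero] at h2
    linarith
  obtain ⟨r, hr, hr'⟩ := Metric.eventually_nhds_iff_ball.1
    ((eventually_nhdsWithin_iff.1 hne).and (hU.mem_nhds hz))
  have hsub : ball z r ⊆ U := fun y hy => (hr' y hy).2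
  have hopen : ∀ s ⊆ ball z r, IsOpen s → IsOpen (f '' s) := by
    refine ((hfa.mono hsub).is_constant_or_isOpen (convex_ball z r).isPreconnected).resolve_left ?_
    rintro ⟨w, hw⟩
    have hzr : z + (r / 2 : ℝ) ∈ ball z r := by
      rw [mem_ball, dist_eq_norm, add_sub_cancel_left, norm_real, Real.norm_eq_abs,
        abs_of_pos (by positivity)]
      linarith
    have h2 := hinj hz (hsub hzr) ((hw _ (mem_ball_self hr)).trans (hw _ hzr).symm)
    rw [left_eq_add, ofReal_eq_zero] at h2
    linarith
  let e₀ := BijOn.toPartialEquiv f (ball z r) _ (hinj.mono hsub).bijOn_image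
  let e : OpenPartialHomeomorph ℂ ℂ := OpenPartialHomeomorph.ofContinuousOpenRestrict e₀
    (hf.continuousOn.mono hsub) (by
      intro s hs
      rw [domRestrict_eq, image_comp]
      refine hopen _ (by rintro _ ⟨y, -, rfl⟩; exact y.2) ?_
      exact isOpen_ball.isOpenMap_subtype_val _ hs) isOpen_ball
  have hzt : f z ∈ e.target := mem_image_of_mem f (mem_ball_self hr)
  have hez : e.symm (f z) = z := e.left_inv (mem_ball_self hr : z ∈ e.source)
  have htn : e.target ∈ 𝓝 (f z) := e.open_target.mem_nhds hzt
  have hda : ∀ᶠ a in 𝓝[≠] f z, DifferentiableAt ℂ e.symm a := by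
    rw [eventually_nhdsWithin_iff]
    filter_upwards [htn] with a ha hane
    have hs := e.map_target ha
    have hne : e.symm a ≠ z := fun h => hane (by rw [mem_singleton_iff, ← h]; exact (e.right_inv ha).symm)
    exact (e.hasDerivAt_symm ha ((hr' _ hs).1 hne)
      (hf.differentiableAt (hU.mem_nhds (hsub hs))).hasDerivAt).differentiableAt
  have han : AnalyticAt ℂ e.symm (f z) :=
    Complex.analyticAt_of_differentiable_on_punctured_nhds_of_continuousAt hda
      (e.continuousAt_symm hzt)
  have hcomp : HasDerivAt (f ∘ e.symm) (deriv f z * deriv e.symm (f z)) (f z) := by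
    refine HasDerivAt.comp (f z) ?_ han.differentiableAt.hasDerivAt
    rw [hez]
    exact (hf.differentiableAt (hU.mem_nhds hz)).hasDerivAt
  have hid : HasDerivAt (f ∘ e.symm) 1 (f z) :=
    (hasDerivAt_id _).congr_of_eventuallyEq (by
      filter_upwards [htn] with a ha using e.right_inv ha)
  intro h0
  rw [h0, zero_mul] at hcomp
  exact zero_ne_one (hcomp.unique hid)

theorem exists_injOn_of_notMem_singularSet {f : ℂ → ℂ} (hf : Continuous f) {z : ℂ}
    (hz : f z ∉ singularSet f) : ∃ U, IsOpen U ∧ z ∈ U ∧ InjOn f U := by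
  obtain ⟨U, hU, hzU, F, hF, -⟩ := IsRegularValue.exists_branches hf (not_not.1 hz)
  obtain ⟨-, h2, h3, h4⟩ := hF z hzU
  refine ⟨F z '' U, h4, ⟨f z, hzU, h3⟩, ?_⟩
  rintro _ ⟨u, hu, rfl⟩ _ ⟨u', hu', rfl⟩ h
  rw [h2 u hu, h2 u' hu'] at h
  rw [h]

theorem deriv_ne_zero_of_notMem_singularSet {f : ℂ → ℂ} (hf : Differentiable ℂ f) {z : ℂ}
    (hz : f z ∉ singularSet f) : deriv f z ≠ 0 := by
  obtain ⟨U, hU, hzU, hi⟩ := exists_injOn_of_notMem_singularSet hf.continuous hz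
  exact deriv_ne_zero_of_injOn hU hf.differentiableOn hi hzU

theorem exists_local_inverse {f : ℂ → ℂ} (hf : Differentiable ℂ f) {z : ℂ}
    (hz : deriv f z ≠ 0) :
    ∃ F : ℂ → ℂ, ContDiffAt ℂ 1 F (f z) ∧ ∀ᶠ y in 𝓝 z, F (f y) = y := by
  have hc : ContDiffAt ℂ 1 f z := hf.contDiff.contDiffAt
  have hd := (hf z).hasDerivAt.hasFDerivAt_equiv hz
  refine ⟨hc.localInverse hd one_ne_zero, hc.to_localInverse hd one_ne_zero, ?_⟩
  exact (hc.hasStrictFDerivAt' hd one_ne_zero).eventually_left_inverse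

theorem eventually_notMem_of_finite {g : ℂ → ℂ} (hg : Differentiable ℂ g)
    (hnc : ¬ ∃ c, ∀ z, g z = c) {S : Set ℂ} (hS : S.Finite) (w : ℂ) :
    ∀ᶠ y in 𝓝[≠] w, g y ∉ S := by
  have hga : AnalyticOnNhd ℂ g univ := fun z _ => hg.analyticAt z
  have : ∀ᶠ y in 𝓝[≠] w, ∀ s ∈ S, g y ≠ s := by
    rw [eventually_all_finite hS]
    intro s _
    rcases (hga w trivial).eventually_eq_or_eventually_ne analyticAt_const (g := fun _ => s)
      with h | h
    · exact absurd ⟨s, fun z => congrFun (hga.eq_of_eventuallyEq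
        (fun _ _ => analyticAt_const) h) z⟩ hnc
    · exact h
  filter_upwards [this] with y hy hyS using hy _ hyS rfl

theorem IsModelMap.comparison_regular {f g : ℂ → ℂ} (hf : Differentiable ℂ f)
    (hg : Differentiable ℂ g) (hgnc : ¬ ∃ c, ∀ z, g z = c) {S : Set ℂ} (hS : S.Finite)
    (hfS : singularSet f ⊆ S) {Ψ : ℂ ≃ₜ ℂ}
    {G : C(unitInterval × ℂ, ℂ)} {χ : ℂ → ℂ} {V : Set ℂ} {c : ℂ} {ρ : ℝ}
    (hM : IsModelMap Ψ S G χ V c ρ) {h : ℂ → ℂ} (hh : Continuous h)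
    (hfh : ∀ w, f (h w) = χ (g w)) (hinj : ∀ w w', g w = g w' → h w = h w' → w = w') :
    ContDiff ℝ 1 h ∧ DifferentiableOn ℂ h (g ⁻¹' V) ∧
      (∀ w, g w ∈ V → ∀ w', h w' = h w → w' = w) ∧ (∀ w, g w ∈ V → deriv h w ≠ 0) ∧
      ∀ w, Ψ (g w) ∉ S →
        ‖deriv f (h w)‖ * ‖fderiv ℝ h w‖ ≤ ‖fderiv ℝ χ (g w)‖ * ‖deriv g w‖ := by
  have hVo : IsOpen (g ⁻¹' V) := hM.isOpen.preimage hg.continuous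
  have hfh' : ∀ w, Ψ (g w) ∉ S → f (h w) ∉ S := fun w hw => by
    rw [hfh, ← hM.one, hM.mem_iff]
    exact hw
  have hder : ∀ w, Ψ (g w) ∉ S → deriv f (h w) ≠ 0 := fun w hw =>
    deriv_ne_zero_of_notMem_singularSet hf fun h' => hfh' w hw (hfS h')
  have hloc : ∀ w, Ψ (g w) ∉ S → ∃ F : ℂ → ℂ, ContDiffAt ℂ 1 F (χ (g w)) ∧
      h =ᶠ[𝓝 w] fun w' => F (χ (g w')) := by
    intro w hw
    obtain ⟨F, hF, hFe⟩ := exists_local_inverse hf (hder w hw)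
    rw [hfh] at hF
    refine ⟨F, hF, ?_⟩
    filter_upwards [hh.continuousAt.eventually hFe] with w' hw'
    rw [← hw', hfh]
  have hgR : ContDiff ℝ 1 g := hg.contDiff.restrict_scalars ℝ
  have hcd : ∀ w, Ψ (g w) ∉ S → ContDiffAt ℝ 1 h w := by
    intro w hw
    obtain ⟨F, hF, hFe⟩ := hloc w hw
    refine ContDiffAt.congr_of_eventuallyEq ?_ hFe
    exact ContDiffAt.comp w (hF.restrict_scalars ℝ) (hM.contDiff.comp hgR).contDiffAt
  have hhol₁ : ∀ w, g w ∈ V → Ψ (g w) ∉ S → DifferentiableAt ℂ h w := by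
    intro w hwV hw
    obtain ⟨F, hF, hFe⟩ := hloc w hw
    obtain ⟨a, ha⟩ := hM.translation _ hwV
    have h1 : DifferentiableAt ℂ (fun w' => χ (g w')) w := by
      refine DifferentiableAt.congr_of_eventuallyEq ((hg w).add_const a) ?_
      exact hg.continuous.continuousAt.eventually ha
    exact DifferentiableAt.congr_of_eventuallyEq
      (DifferentiableAt.comp w (hF.differentiableAt one_ne_zero) h1) hFe
  have hhol : ∀ w, g w ∈ V → DifferentiableAt ℂ h w := by
    intro w hwV
    refine (Complex.analyticAt_of_differentiable_on_punctured_nhds_of_continuousAt ?_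
      hh.continuousAt).differentiableAt
    filter_upwards [nhdsWithin_le_nhds (hVo.mem_nhds hwV), eventually_notMem_of_finite hg hgnc
      (hS.preimage Ψ.injective.injOn) w] with y hyV hyS
    exact hhol₁ y hyV hyS
  have hholV : DifferentiableOn ℂ h (g ⁻¹' V) := fun w hw => (hhol w hw).differentiableWithinAt
  have hVinj : ∀ w, g w ∈ V → ∀ w', h w' = h w → w' = w := by
    intro w hw w' e
    refine hinj _ _ (hM.inj _ hw _ ?_) e
    rw [← hfh, ← hfh, e]
  refine ⟨contDiff_iff_contDiffAt.2 fun w => ?_, hholV, hVinj, fun w hw =>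
    deriv_ne_zero_of_injOn hVo hholV (fun a ha b hb e => (hVinj b hb a e)) hw, fun w hw => ?_⟩
  · by_cases hw : Ψ (g w) ∈ S
    · exact ((hholV.analyticAt (hVo.mem_nhds (hM.mem_of_mem _ hw))).contDiffAt).restrict_scalars ℝ
    · exact hcd w hw
  · have h1 : HasFDerivAt (f ∘ h) (deriv f (h w) • fderiv ℝ h w) w :=
      (hf (h w)).hasDerivAt.comp_hasFDerivAt w
        ((hcd w hw).differentiableAt one_ne_zero).hasFDerivAt
    have h2 : HasFDerivAt (χ ∘ g) ((fderiv ℝ χ (g w)).comp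
        ((fderiv ℂ g w).restrictScalars ℝ)) w :=
      ((hM.contDiff.differentiable one_ne_zero) _).hasFDerivAt.comp w
        ((hg w).hasFDerivAt.restrictScalars ℝ)
    have h3 : f ∘ h = χ ∘ g := funext hfh
    rw [h3] at h1
    rw [← norm_smul, h1.unique h2]
    refine (ContinuousLinearMap.opNorm_comp_le _ _).trans ?_
    rw [ContinuousLinearMap.norm_restrictScalars, ← norm_deriv_eq_norm_fderiv]

theorem lintegral_image_holomorphic {s : Set ℂ} (hs : MeasurableSet s) {F : ℂ → ℂ} {F' : ℂ → ℂ}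
    (hF : ∀ x ∈ s, HasDerivAt F (F' x) x) (hinj : InjOn F s) (φ : ℂ → ℝ≥0∞) :
    ∫⁻ y in F '' s, φ y = ∫⁻ x in s, ENNReal.ofReal (‖F' x‖ ^ 2) * φ (F x) := by
  have h := lintegral_image_eq_lintegral_abs_det_fderiv_mul volume hs
    (fun x hx => (((hF x hx).hasFDerivAt.restrictScalars ℝ).hasFDerivWithinAt (s := s))) hinj φ
  rw [h]
  congr 1 with x
  congr 2
  simp [ContinuousLinearMap.det, LinearMap.det_restrictScalars, Algebra.norm_complex_eq,
    Complex.normSq_eq_norm_sq]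

theorem lintegral_norm_preimage {T : Set ℝ} (hT : MeasurableSet T) {φ : ℂ → ℝ≥0∞}
    (hφ : Measurable φ) :
    ∫⁻ z in norm ⁻¹' T, φ z = ∫⁻ r in Ioi 0 ∩ T, ENNReal.ofReal r *
      ∫⁻ θ in Ioo (-π) π, φ (r * exp (θ * I)) := by
  have hT' : MeasurableSet (norm ⁻¹' T : Set ℂ) := measurable_norm hT
  have hpm : Measurable fun p : ℝ × ℝ => (p.1 : ℂ) * exp (p.2 * I) := by fun_prop
  rw [← lintegral_indicator hT', ← Complex.lintegral_comp_polarCoord_symm]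
  have hind : Measurable ((norm ⁻¹' T : Set ℂ).indicator φ) := hφ.indicator hT'
  have e : ∀ p : ℝ × ℝ, Complex.polarCoord.symm p = (p.1 : ℂ) * exp (p.2 * I) := fun p => by
    rw [Complex.polarCoord_symm_apply, exp_mul_I]; push_cast; rfl
  simp_rw [e]
  rw [_root_.polarCoord_target, Measure.volume_eq_prod, ← Measure.prod_restrict,
    lintegral_prod _ (by
      refine Measurable.aemeasurable ?_
      exact (ENNReal.measurable_ofReal.comp measurable_fst).smul (hind.comp hpm))]
  rw [inter_comm, ← Measure.restrict_restrict hT, ← lintegral_indicator hT]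
  refine setLIntegral_congr_fun measurableSet_Ioi fun r hr => ?_
  have hr : 0 < r := hr
  have hn : ∀ θ : ℝ, ‖(r : ℂ) * exp (θ * I)‖ = r := fun θ => by
    simp [abs_of_pos hr]
  by_cases hrT : r ∈ T
  · rw [indicator_of_mem hrT, ← lintegral_const_mul _ (by fun_prop)]
    congr 1 with θ
    simp only [smul_eq_mul]
    rw [indicator_of_mem]
    rw [mem_preimage, hn]; exact hrT
  · rw [indicator_of_notMem hrT]
    simp only [smul_eq_mul]
    rw [← lintegral_zero]
    congr 1 with θ
    rw [indicator_of_notMem, mul_zero]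
    rw [mem_preimage, hn]; exact hrT

theorem ofReal_norm_sq_le_lintegral_ball {q : ℂ → ℂ} {u : ℂ} {r : ℝ} (hr : 0 < r)
    (hq : DifferentiableOn ℂ q (ball u r)) :
    ENNReal.ofReal (π * r ^ 2) * ENNReal.ofReal (‖q u‖ ^ 2) ≤
      ∫⁻ z in ball u r, ENNReal.ofReal (‖q z‖ ^ 2) := by
  have hint : ∀ s ∈ Ioo 0 r, ENNReal.ofReal (2 * π * ‖q u‖ ^ 2) ≤
      ∫⁻ θ in Ioo (-π) π, ENNReal.ofReal (‖q (u + s * exp (θ * I))‖ ^ 2) := by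
    intro s hs
    have hsub : closedBall u s ⊆ ball u r := closedBall_subset_ball hs.2
    have hcm : ∀ θ : ℝ, u + s * exp (θ * I) ∈ ball u r := fun θ => by
      simp [abs_of_pos hs.1, hs.2]
    have hc : Continuous fun θ : ℝ => q (u + s * exp (θ * I)) :=
      hq.continuousOn.comp_continuous (by fun_prop) hcm
    have h1 : Real.circleAverage (fun z => q z ^ 2) u s = q u ^ 2 := by
      have : DiffContOnCl ℂ (fun z => q z ^ 2) (ball u |s|) := by
        rw [abs_of_pos hs.1]
        refine DifferentiableOn.diffContOnCl ?_
        rw [closure_ball _ hs.1.ne']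
        exact (hq.mono hsub).pow 2
      exact this.circleAverage
    rw [Real.circleAverage_def] at h1
    have hper : ∫ θ in (0)..2 * π, q (circleMap u s θ) ^ 2 =
        ∫ θ in (-π)..π, q (u + s * exp (θ * I)) ^ 2 := by
      have hp : Function.Periodic (fun θ => q (circleMap u s θ) ^ 2) (2 * π) := fun θ => by
        simp only [periodic_circleMap u s θ]
      have := hp.intervalIntegral_add_eq 0 (-π)
      rw [zero_add, show -π + 2 * π = π by ring] at this
      rw [this]; simp [circleMap]
    rw [hper] at h1
    have h2 : 2 * π * ‖q u‖ ^ 2 ≤ ∫ θ in (-π)..π, ‖q (u + s * exp (θ * I))‖ ^ 2 := by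
      have := intervalIntegral.norm_integral_le_integral_norm
        (f := fun θ : ℝ => q (u + s * exp (θ * I)) ^ 2) (μ := volume)
        (show -π ≤ π by linarith [Real.pi_pos])
      simp only [norm_pow] at this
      refine le_trans (le_of_eq ?_) this
      rw [← norm_pow, ← h1, norm_smul, ← mul_assoc]
      have := Real.pi_pos
      rw [Real.norm_of_nonneg (by positivity), mul_inv_cancel₀ (by positivity), one_mul]
    refine (ENNReal.ofReal_le_ofReal h2).trans ?_
    rw [intervalIntegral.integral_of_le (by linarith [Real.pi_pos]),
      integral_Ioc_eq_integral_Ioo,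
      ofReal_integral_eq_lintegral_ofReal]
    · have : Continuous fun θ : ℝ => ‖q (u + s * exp (θ * I))‖ ^ 2 := hc.norm.pow 2
      exact (this.integrableOn_Icc (a := -π) (b := π)).mono_set Ioo_subset_Icc_self
    · exact Eventually.of_forall fun θ => by positivity
  let P : ℂ → ℝ≥0∞ := (ball u r).indicator fun z => ENNReal.ofReal (‖q z‖ ^ 2)
  have hPm : Measurable P := by
    classical
    have := ContinuousOn.measurable_piecewise (s := ball u r)
      (f := fun z => ENNReal.ofReal (‖q z‖ ^ 2)) (g := 0)
      (ENNReal.continuous_ofReal.comp_continuousOn (hq.continuousOn.norm.pow 2))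
      continuous_const.continuousOn measurableSet_ball
    rwa [piecewise_eq_indicator] at this
  have h1 : ∫⁻ z in ball u r, ENNReal.ofReal (‖q z‖ ^ 2) = ∫⁻ z, P (u + z) := by
    rw [lintegral_add_left_eq_self (μ := volume) P u, lintegral_indicator measurableSet_ball]
  have h2 := lintegral_norm_preimage (T := univ) MeasurableSet.univ
    (φ := fun z => P (u + z)) (by fun_prop)
  rw [preimage_univ, Measure.restrict_univ, inter_univ] at h2
  rw [h1, h2]
  have h3 : ∫⁻ s in Ioo 0 r, ENNReal.ofReal s = ENNReal.ofReal (r ^ 2 / 2) := by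
    have hid : IntegrableOn (fun s : ℝ => s) (Ioo 0 r) :=
      (show Continuous fun s : ℝ => s by fun_prop).integrableOn_Icc.mono_set Ioo_subset_Icc_self
    rw [← ofReal_integral_eq_lintegral_ofReal hid ((ae_restrict_iff' measurableSet_Ioo).2
        (Eventually.of_forall fun s hs => hs.1.le)),
      ← integral_Ioc_eq_integral_Ioo, ← intervalIntegral.integral_of_le hr.le]
    simp
  calc ENNReal.ofReal (π * r ^ 2) * ENNReal.ofReal (‖q u‖ ^ 2)
      = ENNReal.ofReal (r ^ 2 / 2) * ENNReal.ofReal (2 * π * ‖q u‖ ^ 2) := by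
        rw [← ENNReal.ofReal_mul (by positivity), ← ENNReal.ofReal_mul (by positivity)]
        congr 1; ring
    _ = ∫⁻ s in Ioo 0 r, ENNReal.ofReal s * ENNReal.ofReal (2 * π * ‖q u‖ ^ 2) := by
        rw [lintegral_mul_const _ ENNReal.measurable_ofReal, h3]
    _ ≤ ∫⁻ s in Ioo 0 r, ENNReal.ofReal s * ∫⁻ θ in Ioo (-π) π, P (u + s * exp (θ * I)) := by
        refine setLIntegral_mono' measurableSet_Ioo fun s hs => ?_
        gcongr
        refine (hint s hs).trans (le_of_eq ?_)
        congr 1 with θ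
        refine (indicator_of_mem (f := fun z => ENNReal.ofReal (‖q z‖ ^ 2)) ?_).symm
        simp [abs_of_pos hs.1, hs.2]
    _ ≤ _ := lintegral_mono_set Ioo_subset_Ioi_self

noncomputable def fiberSum (f : ℂ → ℂ) (R : ℝ) (u : ℂ) : ℝ≥0∞ :=
  ∑' z : {z : ℂ // f z = u ∧ R ≤ ‖z‖}, ENNReal.ofReal (1 / (‖(z : ℂ)‖ * ‖deriv f z‖) ^ 2)

theorem fiberSum_anti {f : ℂ → ℂ} {R R' : ℝ} (h : R ≤ R') (u : ℂ) :
    fiberSum f R' u ≤ fiberSum f R u := by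
  have hinj : Function.Injective (fun z : {z : ℂ // f z = u ∧ R' ≤ ‖z‖} =>
      (⟨z, z.2.1, h.trans z.2.2⟩ : {z : ℂ // f z = u ∧ R ≤ ‖z‖})) := fun a b hab =>
    Subtype.ext (by simpa using hab)
  exact ENNReal.tsum_comp_le_tsum_of_injective hinj
    (fun z => ENNReal.ofReal (1 / (‖(z : ℂ)‖ * ‖deriv f z‖) ^ 2))

theorem hasDerivAt_branch {f F : ℂ → ℂ} {U : Set ℂ} (hf : Differentiable ℂ f) (hU : IsOpen U)
    (hFc : ContinuousOn F U) (hfF : ∀ u ∈ U, f (F u) = u) (hFU : IsOpen (F '' U)) {u : ℂ}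
    (hu : u ∈ U) : HasDerivAt F (deriv f (F u))⁻¹ u := by
  have hinj : InjOn f (F '' U) := by
    rintro _ ⟨a, ha, rfl⟩ _ ⟨b, hb, rfl⟩ h
    rw [hfF a ha, hfF b hb] at h; rw [h]
  exact HasDerivAt.of_local_left_inverse (hFc.continuousAt (hU.mem_nhds hu))
    (hf (F u)).hasDerivAt
    (deriv_ne_zero_of_injOn hFU hf.differentiableOn hinj (mem_image_of_mem F hu))
    (eventually_of_mem (hU.mem_nhds hu) hfF)

theorem ofReal_le_lintegral_branch {f F : ℂ → ℂ} {U : Set ℂ} (hf : Differentiable ℂ f)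
    (hU : IsOpen U) (hFc : ContinuousOn F U) (hfF : ∀ u ∈ U, f (F u) = u)
    (hFU : IsOpen (F '' U)) {u : ℂ} {r : ℝ} (hr : 0 < r) (hur : ball u r ⊆ U)
    (h0 : ∀ v ∈ ball u r, F v ≠ 0) :
    ENNReal.ofReal (π * r ^ 2) * ENNReal.ofReal (1 / (‖F u‖ * ‖deriv f (F u)‖) ^ 2) ≤
      ∫⁻ y in F '' ball u r, ENNReal.ofReal (1 / ‖y‖ ^ 2) := by
  have hd : ∀ v ∈ ball u r, HasDerivAt F (deriv f (F v))⁻¹ v := fun v hv =>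
    hasDerivAt_branch hf hU hFc hfF hFU (hur hv)
  have hFd : DifferentiableOn ℂ F (ball u r) := fun v hv =>
    (hd v hv).differentiableAt.differentiableWithinAt
  have hinj : InjOn F (ball u r) := fun a ha b hb h => by
    rw [← hfF a (hur ha), h, hfF b (hur hb)]
  have hq : DifferentiableOn ℂ (fun v => deriv F v / F v) (ball u r) :=
    (hFd.deriv isOpen_ball).div hFd h0
  have h := ofReal_norm_sq_le_lintegral_ball hr hq
  rw [lintegral_image_holomorphic measurableSet_ball hd hinj]
  have e : ∀ v ∈ ball u r, deriv F v = (deriv f (F v))⁻¹ := fun v hv => (hd v hv).deriv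
  rw [e u (mem_ball_self hr)] at h
  have e' : ∫⁻ v in ball u r, ENNReal.ofReal (‖(deriv f (F v))⁻¹‖ ^ 2) *
      ENNReal.ofReal (1 / ‖F v‖ ^ 2) =
      ∫⁻ v in ball u r, ENNReal.ofReal (‖deriv F v / F v‖ ^ 2) := by
    refine setLIntegral_congr_fun measurableSet_ball fun v hv => ?_
    rw [e v hv, ← ENNReal.ofReal_mul (by positivity), norm_div, norm_inv]
    congr 1; field_simp
  rw [e']
  convert h using 3
  rw [norm_div, norm_inv]; field_simp

theorem exists_bound_sheets {f : ℂ → ℂ} (hf : Continuous f) {U : Set ℂ} {F : ℂ → ℂ → ℂ}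
    (hF : ∀ z, f z ∈ U → ContinuousOn (F z) U ∧ (∀ u ∈ U, f (F z u) = u) ∧ F z (f z) = z ∧
      IsOpen (F z '' U))
    (hFe : ∀ z z' u, f z ∈ U → f z' ∈ U → u ∈ U → F z u = F z' u → EqOn (F z) (F z') U)
    {K : Set ℂ} (hK : IsCompact K) (hKU : K ⊆ U) :
    ∃ R : ℝ, ∀ y, ‖y‖ ≤ 1 → f y ∈ K → ∀ u ∈ K, ‖F y u‖ ≤ R := by
  have hc : IsCompact (closedBall (0 : ℂ) 1 ∩ f ⁻¹' K) :=
    (isCompact_closedBall 0 1).inter_right (hK.isClosed.preimage hf)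
  have : ∃ R : ℝ, ∀ y ∈ closedBall (0 : ℂ) 1 ∩ f ⁻¹' K, ∀ u ∈ K, ‖F y u‖ ≤ R := by
    refine hc.induction_on (p := fun s => ∃ R : ℝ, ∀ y ∈ s, ∀ u ∈ K, ‖F y u‖ ≤ R)
      ⟨0, by simp⟩ (fun s t hst ⟨R, hR⟩ => ⟨R, fun y hy => hR y (hst hy)⟩) ?_ ?_
    · rintro s t ⟨R, hR⟩ ⟨R', hR'⟩
      refine ⟨max R R', fun y hy u hu => ?_⟩
      rcases hy with hy | hy
      · exact (hR y hy u hu).trans (le_max_left _ _)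
      · exact (hR' y hy u hu).trans (le_max_right _ _)
    · rintro y ⟨-, hy⟩
      have hy : f y ∈ K := hy
      obtain ⟨h1, h2, h3, h4⟩ := hF y (hKU hy)
      obtain ⟨R, hR⟩ := hK.exists_bound_of_continuousOn (h1.mono hKU)
      refine ⟨F y '' U, mem_nhdsWithin_of_mem_nhds
        (h4.mem_nhds ⟨f y, hKU hy, h3⟩), R, ?_⟩
      rintro _ ⟨v, hv, rfl⟩ u hu
      have hv' : f (F y v) ∈ U := by rwa [h2 v hv]
      have := (hF (F y v) hv').2.2.1
      rw [h2 v hv] at this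
      rw [hFe _ _ v hv' (hKU hy) hv this (hKU hu)]
      exact hR u hu
  obtain ⟨R, hR⟩ := this
  exact ⟨R, fun y h1 h2 => hR y ⟨by simpa using h1, h2⟩⟩

theorem AreaProperty.exists_fiberSum_le_local {f : ℂ → ℂ} (harea : AreaProperty f)
    (hf : Differentiable ℂ f) {w : ℂ} (hw : w ∉ singularSet f) :
    ∃ r > 0, ∃ R : ℝ, ∃ B < (⊤ : ℝ≥0∞), ∀ u ∈ ball w r, fiberSum f R u ≤ B := by
  have hopen : IsOpen (singularSet f)ᶜ := by
    rw [isOpen_iff_mem_nhds]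
    intro x hx
    obtain ⟨U, hU, hxU, h⟩ : IsRegularValue f x := by
      by_contra hc; exact hx hc
    exact mem_of_superset (hU.mem_nhds hxU) fun y hy hc => hc ⟨U, hU, hy, h⟩
  have hreg : IsRegularValue f w := by by_contra hc; exact hw hc
  obtain ⟨U, hU, hwU, F, hF, hFe⟩ := hreg.exists_branches hf.continuous
  obtain ⟨ε, hε, hεU⟩ := Metric.isOpen_iff.1 (hU.inter hopen) w ⟨hwU, hw⟩
  obtain ⟨r, hr, hrε⟩ : ∃ r > 0, 2 * r < ε := ⟨ε / 4, by positivity, by linarith⟩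
  have hK : closedBall w (2 * r) ⊆ U ∩ (singularSet f)ᶜ :=
    (closedBall_subset_ball hrε).trans hεU
  have hKU : closedBall w (2 * r) ⊆ U := hK.trans inter_subset_left
  obtain ⟨R, hR⟩ := exists_bound_sheets hf.continuous hF hFe (isCompact_closedBall w (2 * r)) hKU
  set A := cylArea (f ⁻¹' closedBall w (2 * r) \ ball (0 : ℂ) 1) with hA
  have hA' : A < ⊤ := harea _ (isCompact_closedBall w (2 * r)) (hK.trans inter_subset_right)
  have hc0 : ENNReal.ofReal (π * r ^ 2) ≠ 0 := by
    simpa using (by positivity : 0 < π * r ^ 2)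
  refine ⟨r, hr, R + 1, A / ENNReal.ofReal (π * r ^ 2), ENNReal.div_lt_top hA'.ne hc0,
    fun u hu => ?_⟩
  have hub : ball u r ⊆ closedBall w (2 * r) := fun v hv => by
    rw [mem_ball] at hv hu
    rw [mem_closedBall]
    linarith [dist_triangle v u w]
  have huU : u ∈ U := hKU (hub (mem_ball_self hr))
  rw [ENNReal.le_div_iff_mul_le (Or.inl hc0) (Or.inl ENNReal.ofReal_ne_top), mul_comm, fiberSum,
    ENNReal.tsum_eq_iSup_sum, ENNReal.mul_iSup]
  refine iSup_le fun T => ?_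
  have hzU : ∀ z : {z : ℂ // f z = u ∧ R + 1 ≤ ‖z‖}, f z ∈ U := fun z => by
    rw [z.2.1]; exact huU
  have hFz : ∀ z : {z : ℂ // f z = u ∧ R + 1 ≤ ‖z‖}, F z u = z := fun z => by
    have := (hF z (hzU z)).2.2.1
    rwa [z.2.1] at this
  have hlarge : ∀ z : {z : ℂ // f z = u ∧ R + 1 ≤ ‖z‖}, ∀ v ∈ closedBall w (2 * r),
      1 < ‖F z v‖ := fun z v hv => by
    by_contra! hc
    have hfv := (hF z (hzU z)).2.1 v (hKU hv)
    have h1 := hR (F z v) hc (by rwa [hfv]) u (hub (mem_ball_self hr))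
    have hv' : f (F z v) ∈ U := by rw [hfv]; exact hKU hv
    have h2 := (hF (F z v) hv').2.2.1
    rw [hfv] at h2
    rw [hFe _ _ v hv' (hzU z) (hKU hv) h2 huU, hFz z] at h1
    linarith [z.2.2]
  have himg : ∀ z : {z : ℂ // f z = u ∧ R + 1 ≤ ‖z‖}, IsOpen (F z '' ball u r) := fun z => by
    have h4 := (hF z (hzU z)).2.2.2
    have : F z '' ball u r = F z '' U ∩ f ⁻¹' ball u r := by
      ext y; constructor
      · rintro ⟨v, hv, rfl⟩
        have hv' := hKU (hub hv)
        exact ⟨⟨v, hv', rfl⟩, by rw [mem_preimage, (hF z (hzU z)).2.1 v hv']; exact hv⟩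
      · rintro ⟨⟨v, hv, rfl⟩, h⟩
        rw [mem_preimage, (hF z (hzU z)).2.1 v hv] at h
        exact ⟨v, h, rfl⟩
    rw [this]
    exact h4.inter (isOpen_ball.preimage hf.continuous)
  have hdisj : (T : Set {z : ℂ // f z = u ∧ R + 1 ≤ ‖z‖}).PairwiseDisjoint
      fun z => F z '' ball u r := by
    intro z _ z' _ hne
    rw [Function.onFun, Set.disjoint_left]
    rintro _ ⟨v, hv, rfl⟩ ⟨v', hv', he⟩
    have hvU := hKU (hub hv)
    have hvU' := hKU (hub hv')
    have : v' = v := by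
      rw [← (hF z' (hzU z')).2.1 v' hvU', he, (hF z (hzU z)).2.1 v hvU]
    subst this
    have := hFe _ _ v' (hzU z') (hzU z) hvU he huU
    rw [hFz, hFz] at this
    exact hne (Subtype.ext this.symm)
  calc ENNReal.ofReal (π * r ^ 2) *
        ∑ z ∈ T, ENNReal.ofReal (1 / (‖(z : ℂ)‖ * ‖deriv f z‖) ^ 2)
      = ∑ z ∈ T, ENNReal.ofReal (π * r ^ 2) *
          ENNReal.ofReal (1 / (‖(z : ℂ)‖ * ‖deriv f z‖) ^ 2) := Finset.mul_sum _ _ _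
    _ ≤ ∑ z ∈ T, ∫⁻ y in F z '' ball u r, ENNReal.ofReal (1 / ‖y‖ ^ 2) := by
        refine Finset.sum_le_sum fun z _ => ?_
        obtain ⟨h1, h2, h3, h4⟩ := hF z (hzU z)
        have := ofReal_le_lintegral_branch hf hU h1 h2 h4 hr (hub.trans hKU) fun v hv h0 => by
          have := hlarge z v (hub hv)
          rw [h0, norm_zero] at this; linarith
        rwa [hFz z] at this
    _ = ∫⁻ y in ⋃ z ∈ T, F z '' ball u r, ENNReal.ofReal (1 / ‖y‖ ^ 2) :=
        (lintegral_biUnion_finset hdisj (fun z _ => (himg z).measurableSet) _).symm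
    _ ≤ A := by
        rw [hA, cylArea]
        refine lintegral_mono_set (iUnion₂_subset fun z _ => ?_)
        rintro _ ⟨v, hv, rfl⟩
        refine ⟨?_, ?_⟩
        · rw [mem_preimage, (hF z (hzU z)).2.1 v (hKU (hub hv))]; exact hub hv
        · have := hlarge z v (hub hv)
          simpa using this.le

theorem AreaProperty.exists_fiberSum_le {f : ℂ → ℂ} (harea : AreaProperty f)
    (hf : Differentiable ℂ f) {K : Set ℂ} (hK : IsCompact K) (hKS : K ⊆ (singularSet f)ᶜ) :
    ∃ R : ℝ, ∃ B < (⊤ : ℝ≥0∞), ∀ u ∈ K, fiberSum f R u ≤ B := by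
  refine hK.induction_on
    (p := fun s => ∃ R : ℝ, ∃ B < (⊤ : ℝ≥0∞), ∀ u ∈ s, fiberSum f R u ≤ B)
    ⟨0, 0, by simp⟩ (fun s t hst ⟨R, B, hB, h⟩ => ⟨R, B, hB, fun u hu => h u (hst hu)⟩) ?_ ?_
  · rintro s t ⟨R, B, hB, h⟩ ⟨R', B', hB', h'⟩
    refine ⟨max R R', max B B', max_lt hB hB', fun u hu => ?_⟩
    rcases hu with hu | hu
    · exact (fiberSum_anti (le_max_left _ _) u).trans ((h u hu).trans (le_max_left _ _))
    · exact (fiberSum_anti (le_max_right _ _) u).trans ((h' u hu).trans (le_max_right _ _))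
  · intro w hw
    obtain ⟨r, hr, R, B, hB, h⟩ := harea.exists_fiberSum_le_local hf (hKS hw)
    exact ⟨ball w r, mem_nhdsWithin_of_mem_nhds (ball_mem_nhds w hr), R, B, hB, h⟩

theorem sum_lintegral_le_lintegral_sum {α ι : Type*} [MeasurableSpace α] (μ : Measure α)
    (T : Finset ι) (φ : ι → α → ℝ≥0∞) :
    ∑ i ∈ T, ∫⁻ x, φ i x ∂μ ≤ ∫⁻ x, ∑ i ∈ T, φ i x ∂μ := by
  classical
  induction T using Finset.induction_on with
  | empty => simp
  | insert a T ha ih =>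
    simp_rw [Finset.sum_insert ha]
    exact (add_le_add_right ih _).trans (le_lintegral_add _ _)

theorem lintegral_norm_deriv_sq_mul_le {g : ℂ → ℂ} (hg : Differentiable ℂ g) {E Q : Set ℂ}
    (hE : MeasurableSet E) (hQ : MeasurableSet Q) (hEQ : ∀ w ∈ E, g w ∈ Q)
    (hloc : ∀ w ∈ E, ∃ U, IsOpen U ∧ w ∈ U ∧ InjOn g U) {φ : ℂ → ℝ≥0∞} {B : ℝ≥0∞}
    (hB : ∀ v ∈ Q, ∑' w : {w : ℂ // g w = v ∧ w ∈ E}, φ w ≤ B) :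
    ∫⁻ w in E, ENNReal.ofReal (‖deriv g w‖ ^ 2) * φ w ≤ B * volume Q := by
  classical
  rcases E.eq_empty_or_nonempty with rfl | hne
  · simp
  choose! U hU hwU hUi using hloc
  obtain ⟨t, htE, htc, hcov⟩ := TopologicalSpace.countable_cover_nhdsWithin (s := E) (f := U)
    fun w hw => mem_nhdsWithin_of_mem_nhds ((hU w hw).mem_nhds (hwU w hw))
  have htne : t.Nonempty := by
    obtain ⟨w, hw⟩ := hne
    obtain ⟨x, hx⟩ := mem_iUnion.1 (hcov hw)
    obtain ⟨hxt, -⟩ := mem_iUnion.1 hx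
    exact ⟨x, hxt⟩
  obtain ⟨e, rfl⟩ := htc.exists_eq_range htne
  have heE : ∀ n, e n ∈ E := fun n => htE (mem_range_self n)
  let A : ℕ → Set ℂ := fun n => E ∩ disjointed (fun n => U (e n)) n
  have hAm : ∀ n, MeasurableSet (A n) := fun n =>
    hE.inter (MeasurableSet.disjointed (fun n => (hU _ (heE n)).measurableSet) n)
  have hAd : Pairwise (Function.onFun Disjoint A) := fun m n hmn =>
    (disjoint_disjointed (fun n => U (e n)) hmn).mono inter_subset_right inter_subset_right
  have hAU : ⋃ n, A n = E := by
    rw [← inter_iUnion, iUnion_disjointed, inter_eq_left]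
    simpa using hcov
  have hAi : ∀ n, InjOn g (A n) := fun n =>
    (hUi _ (heE n)).mono (inter_subset_right.trans (disjointed_subset _ n))
  have hgA : ∀ n, MeasurableSet (g '' A n) := fun n =>
    (hAm n).image_of_continuousOn_injOn hg.continuous.continuousOn (hAi n)
  let G : ℕ → ℂ → ℂ := fun n => Function.invFunOn g (A n)
  have hterm : ∀ n, ∫⁻ w in A n, ENNReal.ofReal (‖deriv g w‖ ^ 2) * φ w =
      ∫⁻ v, (g '' A n).indicator (fun v => φ (G n v)) v := fun n => by
    rw [lintegral_indicator (hgA n), lintegral_image_holomorphic (hAm n)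
      (fun x _ => (hg x).hasDerivAt) (hAi n)]
    refine setLIntegral_congr_fun (hAm n) fun w hw => ?_
    simp only [G]
    rw [(hAi n).leftInvOn_invFunOn hw]
  conv_lhs => rw [← hAU]
  rw [lintegral_iUnion hAm hAd, ENNReal.tsum_eq_iSup_sum]
  refine iSup_le fun T => ?_
  simp_rw [hterm]
  refine (sum_lintegral_le_lintegral_sum _ _ _).trans ?_
  rw [← setLIntegral_const, ← lintegral_indicator hQ]
  refine lintegral_mono fun v => ?_
  by_cases hv : v ∈ Q
  · rw [indicator_of_mem hv]
    refine le_trans ?_ (hB v hv)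
    have hG : ∀ n, v ∈ g '' A n → G n v ∈ A n ∧ g (G n v) = v := fun n hn =>
      ⟨Function.invFunOn_mem hn, Function.invFunOn_eq hn⟩
    calc ∑ n ∈ T, (g '' A n).indicator (fun v => φ (G n v)) v
        = ∑ n ∈ T with v ∈ g '' A n, φ (G n v) := by
          rw [Finset.sum_filter]
          exact Finset.sum_congr rfl fun n _ => indicator_apply _ _ _
      _ = ∑' n : {n // n ∈ T.filter fun n => v ∈ g '' A n}, φ (G n v) := by
          rw [tsum_fintype, ← Finset.sum_coe_sort]
      _ ≤ _ := by
          let i : {n // n ∈ T.filter fun n => v ∈ g '' A n} → {w : ℂ // g w = v ∧ w ∈ E} :=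
            fun n => ⟨G n v, (hG n (Finset.mem_filter.1 n.2).2).2,
              (hG n (Finset.mem_filter.1 n.2).2).1.1⟩
          have hi : Function.Injective i := by
            intro m n hmn
            by_contra hne
            have hm := (hG m (Finset.mem_filter.1 m.2).2).1
            have hn := (hG n (Finset.mem_filter.1 n.2).2).1
            have h1 : G m v = G n v := congrArg Subtype.val hmn
            rw [h1] at hm
            exact Set.disjoint_left.1 (hAd fun h => hne (Subtype.ext h)) hm hn
          exact ENNReal.tsum_comp_le_tsum_of_injective hi (fun w => φ w)
  · have : ∀ n ∈ T, (g '' A n).indicator (fun v => φ (G n v)) v = 0 := fun n _ => by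
      refine indicator_of_notMem ?_ _
      rintro ⟨w, hw, rfl⟩
      exact hv (hEQ w hw.1)
    rw [Finset.sum_eq_zero this]; exact zero_le

theorem AreaProperty.exists_energy_lt_top {f g h χ : ℂ → ℂ} (harea : AreaProperty f)
    (hf : Differentiable ℂ f) (hg : Differentiable ℂ g) (hh : Continuous h)
    (hχ : ContDiff ℝ 1 χ) {Q : Set ℂ} (hQ : IsCompact Q) (hfh : ∀ w, f (h w) = χ (g w))
    (hinj : ∀ w w', g w = g w' → h w = h w' → w = w')
    (hQS : χ '' Q ⊆ (singularSet f)ᶜ)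
    (hloc : ∀ w, g w ∈ Q → ∃ U, IsOpen U ∧ w ∈ U ∧ InjOn g U)
    (hder : ∀ w, g w ∈ Q →
      ‖deriv f (h w)‖ * ‖fderiv ℝ h w‖ ≤ ‖fderiv ℝ χ (g w)‖ * ‖deriv g w‖) :
    ∃ R : ℝ, ∫⁻ w in g ⁻¹' Q ∩ {w | R ≤ ‖h w‖},
      ENNReal.ofReal ((‖fderiv ℝ h w‖ / ‖h w‖) ^ 2) < ⊤ := by
  obtain ⟨R, B, hB, hfib⟩ := harea.exists_fiberSum_le hf (hQ.image hχ.continuous) hQS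
  obtain ⟨C, hC⟩ := hQ.exists_bound_of_continuousOn
    (hχ.continuous_fderiv one_ne_zero).continuousOn
  refine ⟨R, ?_⟩
  set E := g ⁻¹' Q ∩ {w | R ≤ ‖h w‖} with hEdef
  have hE : MeasurableSet E := ((hQ.isClosed.preimage hg.continuous).inter
    (isClosed_le continuous_const hh.norm)).measurableSet
  have hd0 : ∀ w, g w ∈ Q → deriv f (h w) ≠ 0 := fun w hw =>
    deriv_ne_zero_of_notMem_singularSet hf (by
      rw [hfh]; exact hQS (mem_image_of_mem χ hw))
  let φ : ℂ → ℝ≥0∞ := fun w =>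
    ENNReal.ofReal (C ^ 2) * ENNReal.ofReal (1 / (‖h w‖ * ‖deriv f (h w)‖) ^ 2)
  have h1 := lintegral_norm_deriv_sq_mul_le hg hE hQ.measurableSet (φ := φ)
    (B := ENNReal.ofReal (C ^ 2) * B) (fun w hw => hw.1) (fun w hw => hloc w hw.1) (by
      intro v hv
      rw [ENNReal.tsum_mul_left]
      refine mul_le_mul_right (le_trans ?_ (hfib (χ v) (mem_image_of_mem χ hv))) _
      let i : {w : ℂ // g w = v ∧ w ∈ E} → {z : ℂ // f z = χ v ∧ R ≤ ‖z‖} :=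
        fun w => ⟨h w, by rw [hfh, w.2.1], w.2.2.2⟩
      have hi : Function.Injective i := fun a b hab =>
        Subtype.ext (hinj _ _ (a.2.1.trans b.2.1.symm) (congrArg Subtype.val hab))
      exact ENNReal.tsum_comp_le_tsum_of_injective hi
        (fun z => ENNReal.ofReal (1 / (‖(z : ℂ)‖ * ‖deriv f z‖) ^ 2)))
  refine lt_of_le_of_lt ?_ (h1.trans_lt (ENNReal.mul_lt_top
    (ENNReal.mul_lt_top ENNReal.ofReal_lt_top hB) hQ.measure_lt_top))
  refine setLIntegral_mono' hE fun w hw => ?_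
  simp only [φ]
  rw [← ENNReal.ofReal_mul (by positivity), ← ENNReal.ofReal_mul (by positivity)]
  refine ENNReal.ofReal_le_ofReal ?_
  have hd := norm_pos_iff.2 (hd0 w hw.1)
  have hle : ‖fderiv ℝ h w‖ ≤ C * ‖deriv g w‖ / ‖deriv f (h w)‖ := by
    rw [le_div_iff₀ hd, mul_comm]
    exact (hder w hw.1).trans (mul_le_mul_of_nonneg_right (hC _ hw.1) (norm_nonneg _))
  calc (‖fderiv ℝ h w‖ / ‖h w‖) ^ 2
      ≤ (C * ‖deriv g w‖ / ‖deriv f (h w)‖ / ‖h w‖) ^ 2 := by gcongr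
    _ = _ := by field_simp

section GrowthComparison

variable {d Y M m : ℝ → ℝ} {s₀ C K : ℝ}

theorem eventually_le_of_sq_le_deriv (hd : ∀ s ≥ s₀, HasDerivAt Y (d s) s)
    (hd1 : ∀ s ≥ s₀, 0 ≤ d s) (hK : 0 < K)
    (h : ∀ s ≥ s₀, 0 ≤ Y s - s - C → (Y s - s - C) ^ 2 ≤ K * d s) {ε : ℝ} (hε : 0 < ε) :
    ∀ᶠ s in atTop, Y s ≤ (1 + ε) * s := by
  set c : ℝ := ε / 2 / (1 + ε / 2) with hc
  have hcpos : 0 < c := by positivity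
  set κ : ℝ := (c / 2) ^ 2 / K with hκ
  have hκpos : 0 < κ := by positivity
  have hlarge : ∀ᶠ s : ℝ in atTop, 1 < κ * c * s * s := by
    have : Tendsto (fun s : ℝ => κ * c * s * s) atTop atTop :=
      (tendsto_id.const_mul_atTop (by positivity)).atTop_mul_atTop₀ tendsto_id
    exact this.eventually_gt_atTop 1
  filter_upwards [hlarge, eventually_ge_atTop s₀, eventually_gt_atTop 0,
    eventually_ge_atTop (C / (c / 2))] with s₁ h1 h2 h3 h4
  by_contra! hcon
  set s₂ : ℝ := s₁ * (1 + c) with hs₂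
  have hs12 : s₁ < s₂ := by rw [hs₂]; nlinarith
  have hs2e : (1 + ε / 2) * s₂ = (1 + ε) * s₁ := by
    rw [hs₂, hc]; field_simp; ring
  have hmono : MonotoneOn Y (Icc s₁ s₂) := by
    refine monotoneOn_of_deriv_nonneg (convex_Icc _ _)
      (fun x hx => (hd x (h2.trans hx.1)).continuousAt.continuousWithinAt) ?_ ?_
    · intro x hx; rw [interior_Icc] at hx
      exact (hd x (h2.trans hx.1.le)).differentiableAt.differentiableWithinAt
    · intro x hx; rw [interior_Icc] at hx
      rw [(hd x (h2.trans hx.1.le)).deriv]; exact hd1 x (h2.trans hx.1.le)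
  have hY1 : ∀ s ∈ Icc s₁ s₂, s₁ < Y s := fun s hs => by
    have := hmono (left_mem_Icc.2 hs12.le) hs hs.1
    nlinarith
  have hY2 : ∀ s ∈ Icc s₁ s₂, κ * Y s ^ 2 ≤ d s := fun s hs => by
    have ha := hmono (left_mem_Icc.2 hs12.le) hs hs.1
    have hb : (1 + ε / 2) * s ≤ Y s := by
      have := mul_le_mul_of_nonneg_left hs.2 (by positivity : 0 ≤ 1 + ε / 2)
      linarith
    have hs' : s ≤ Y s - c * Y s := by
      have : s ≤ Y s / (1 + ε / 2) := by rw [le_div_iff₀ (by positivity)]; linarith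
      refine this.trans (le_of_eq ?_)
      rw [hc]; field_simp; ring
    have hC : C ≤ c / 2 * Y s := by
      have hh := (div_le_iff₀ (by positivity)).1 h4
      have := mul_lt_mul_of_pos_left (hY1 s hs) (by positivity : 0 < c / 2)
      linarith
    have hYp := h3.trans (hY1 s hs)
    have hlow : c / 2 * Y s ≤ Y s - s - C := by linarith
    have hq := h s (h2.trans hs.1) ((by positivity : 0 ≤ c / 2 * Y s).trans hlow)
    have : (c / 2 * Y s) ^ 2 ≤ K * d s :=
      (pow_le_pow_left₀ (by positivity) hlow 2).trans hq
    rw [hκ, div_mul_eq_mul_div, div_le_iff₀ hK]; linarith [mul_pow (c / 2) (Y s) 2]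
  have hφ : MonotoneOn (fun s => -(Y s)⁻¹ - κ * s) (Icc s₁ s₂) := by
    have hder : ∀ s ∈ Icc s₁ s₂,
        HasDerivAt (fun s => -(Y s)⁻¹ - κ * s) (-(-d s / Y s ^ 2) - κ * 1) s := fun s hs =>
      ((hd s (h2.trans hs.1)).inv (h3.trans (hY1 s hs)).ne').neg.sub
        ((hasDerivAt_id s).const_mul κ)
    refine monotoneOn_of_deriv_nonneg (convex_Icc _ _)
      (fun x hx => (hder x hx).continuousAt.continuousWithinAt) ?_ ?_
    · intro x hx
      exact (hder x (interior_subset hx)).differentiableAt.differentiableWithinAt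
    · intro x hx
      have hx' := interior_subset hx
      rw [(hder x hx').deriv, neg_div, neg_neg, mul_one, sub_nonneg, le_div_iff₀ (by
        have := h3.trans (hY1 x hx'); positivity)]
      exact hY2 x hx'
  have := hφ (left_mem_Icc.2 hs12.le) (right_mem_Icc.2 hs12.le) hs12.le
  simp only at this
  have hp1 : 0 < (Y s₂)⁻¹ := inv_pos.2 (h3.trans (hY1 s₂ (right_mem_Icc.2 hs12.le)))
  have hp2 : (Y s₁)⁻¹ ≤ s₁⁻¹ :=
    inv_anti₀ h3 (hY1 s₁ (left_mem_Icc.2 hs12.le)).le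
  have h5 : κ * (s₂ - s₁) ≤ s₁⁻¹ := by linarith
  have h6 : κ * (s₂ - s₁) * s₁ ≤ 1 := by
    have := mul_le_mul_of_nonneg_right h5 h3.le
    rwa [inv_mul_cancel₀ h3.ne'] at this
  rw [hs₂] at h6
  nlinarith

theorem exists_radii (hd : ∀ s ≥ s₀, HasDerivAt Y (d s) s) (hY0 : Y s₀ = 0)
    (hd1 : ∀ s ≥ s₀, 1 ≤ d s) (hK : 0 < K)
    (hosc : ∀ s ≥ s₀, (M s - m s) ^ 2 ≤ K * d s) (hYM : ∀ s ≥ s₀, Y s ≤ M s + C)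
    (hmY : ∀ s ≥ s₀, m s ≤ (Y s + s) / 2 + C) {ε : ℝ} (hε : 0 < ε) :
    ∀ᶠ s in atTop, (∃ s' > s, s₀ ≤ s' ∧ M s' ≤ (1 + ε) * s) ∧
      ∃ s' < s, s₀ ≤ s' ∧ (1 - ε) * s ≤ m s' := by
  obtain ⟨δ, hδ, hδ1, hδε⟩ : ∃ δ > 0, δ < 1 ∧ 4 * δ ≤ ε :=
    ⟨min (ε / 4) (1 / 2), by positivity, (min_le_right _ _).trans_lt (by norm_num),
      by linarith [min_le_left (ε / 4) (1 / 2 : ℝ)]⟩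
  have hYup := eventually_le_of_sq_le_deriv (C := 4 * C) (K := 4 * K) hd
    (fun s hs => zero_le_one.trans (hd1 s hs)) (by positivity) (fun s hs h0 => by
      have h1 := hYM s hs
      have h2 := hmY s hs
      have h3 : Y s - s - 4 * C ≤ 2 * (M s - m s) := by linarith
      have := pow_le_pow_left₀ h0 h3 2
      nlinarith [hosc s hs]) hδ
  have hYlow : ∀ s ≥ s₀, s - s₀ ≤ Y s := by
    intro s hs
    have hmono : MonotoneOn (fun s => Y s - s) (Ici s₀) := by
      have hder : ∀ s ∈ Ici s₀, HasDerivAt (fun s => Y s - s) (d s - 1) s := fun s hs =>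
        (hd s hs).sub (hasDerivAt_id s)
      refine monotoneOn_of_deriv_nonneg (convex_Ici _)
        (fun x hx => (hder x hx).continuousAt.continuousWithinAt) ?_ ?_
      · intro x hx
        exact (hder x (interior_subset hx)).differentiableAt.differentiableWithinAt
      · intro x hx
        rw [(hder x (interior_subset hx)).deriv, sub_nonneg]
        exact hd1 x (interior_subset hx)
    have := hmono self_mem_Ici hs hs
    simp only [hY0] at this; linarith
  have hosc' : ∀ s ≥ s₀, d s ≤ 4 / δ → M s - m s ≤ √(K * (4 / δ)) := fun s hs h => by
    refine Real.le_sqrt_of_sq_le ((hosc s hs).trans ?_)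
    gcongr
  set D := √(K * (4 / δ)) with hD
  have hYnn : ∀ s ≥ s₀, 0 ≤ Y s := fun s hs => (by linarith : 0 ≤ s - s₀).trans (hYlow s hs)
  have hmul : Tendsto (fun s : ℝ => (1 + δ) * s) atTop atTop :=
    tendsto_id.const_mul_atTop (by positivity)
  have hmul' : Tendsto (fun s : ℝ => (1 - δ) * s) atTop atTop :=
    tendsto_id.const_mul_atTop (by linarith)
  filter_upwards [eventually_gt_atTop 0, eventually_ge_atTop s₀, hYup,
    hmul.eventually (eventually_forall_ge_atTop.2 hYup), eventually_forall_ge_atTop.2 hYup,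
    hmul'.eventually_ge_atTop s₀, eventually_ge_atTop ((D + C) / δ),
    eventually_ge_atTop ((D + C + s₀) / δ)] with s hs hss₀ hY1 hY2 hYall hs' hlarge hlarge'
  rw [div_le_iff₀ hδ] at hlarge hlarge'
  constructor
  · have hlt : s < (1 + δ) * s := by nlinarith
    obtain ⟨x, hx, hxe⟩ := exists_hasDerivAt_eq_slope Y d hlt
      (fun x hx => (hd x (hss₀.trans hx.1)).continuousAt.continuousWithinAt)
      (fun x hx => hd x (hss₀.trans hx.1.le))
    have hx0 : s₀ ≤ x := hss₀.trans hx.1.le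
    have hdx : d x ≤ 4 / δ := by
      rw [hxe, div_le_div_iff₀ (by linarith) hδ]
      have h1 := hYnn s hss₀
      have h2 := hY2 _ le_rfl
      have h3 : (1 + δ) * ((1 + δ) * s) ≤ 4 * s := by nlinarith
      nlinarith
    refine ⟨x, hx.1, hx0, ?_⟩
    have h1 := hosc' x hx0 hdx
    have h2 := hmY x hx0
    have h3 := hYall x hx.1.le
    have h4 : M x ≤ (1 + δ) * x + (D + C) := by nlinarith [hx.2, hx.1]
    have h5 : (1 + δ) * x ≤ (1 + δ) * ((1 + δ) * s) := by gcongr; exact hx.2.le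
    have h6 : (1 + δ) * ((1 + δ) * s) ≤ (1 + 3 * δ) * s := by nlinarith
    nlinarith
  · have hlt : (1 - δ) * s < s := by nlinarith
    obtain ⟨x, hx, hxe⟩ := exists_hasDerivAt_eq_slope Y d hlt
      (fun x hx => (hd x (hs'.trans hx.1)).continuousAt.continuousWithinAt)
      (fun x hx => hd x (hs'.trans hx.1.le))
    have hx0 : s₀ ≤ x := hs'.trans hx.1.le
    have hdx : d x ≤ 4 / δ := by
      rw [hxe, div_le_div_iff₀ (by linarith) hδ]
      have h1 := hYnn _ hs'
      nlinarith
    refine ⟨x, hx.2, hx0, ?_⟩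
    have h1 := hosc' x hx0 hdx
    have h2 := hYM x hx0
    have h3 := hYlow x hx0
    have h4 : (1 - δ) * s - (D + C + s₀) ≤ m x := by linarith [hx.1]
    nlinarith

end GrowthComparison

/-- A proper `C¹` self-map of the plane that is holomorphic and injective over an open set `W`,
with finite logarithmic energy on the complement of `W`. -/
structure IsNearlyConformal (h : ℂ → ℂ) (W : Set ℂ) (R : ℝ) : Prop where
  contDiff : ContDiff ℝ 1 h
  isOpen : IsOpen W
  nonempty : W.Nonempty
  tendsto : Tendsto h (cocompact ℂ) (cocompact ℂ)
  differentiableOn : DifferentiableOn ℂ h W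
  inj : ∀ w ∈ W, ∀ w', h w' = h w → w' = w
  deriv_ne_zero : ∀ w ∈ W, deriv h w ≠ 0
  energy : ∫⁻ w in Wᶜ ∩ {w | R ≤ ‖h w‖}, ENNReal.ofReal ((‖fderiv ℝ h w‖ / ‖h w‖) ^ 2) < ⊤

theorem not_exists_continuousOn_log_sphere {t : ℝ} (ht : 0 < t) {m : ℂ → ℂ}
    (hm : ContinuousOn m (sphere 0 t)) (he : ∀ w ∈ sphere (0 : ℂ) t, exp (m w) = w) : False := by
  have hs : ∀ θ : ℝ, (t : ℂ) * exp (θ * I) ∈ sphere (0 : ℂ) t := fun θ => by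
    simp [abs_of_pos ht]
  have hlt : exp (Real.log t : ℂ) = t := by
    rw [← ofReal_exp, Real.exp_log ht]
  obtain ⟨n, hn⟩ := exists_int_of_exp_eq (s := (univ : Set ℝ)) isPreconnected_univ
    (k₁ := fun θ : ℝ => m (t * exp (θ * I))) (k₂ := fun θ : ℝ => (Real.log t : ℂ) + θ * I)
    (hm.comp (by fun_prop) fun θ _ => hs θ) (by fun_prop)
    (fun θ _ => by rw [he _ (hs θ), exp_add, hlt])
  have h0 := hn 0 trivial
  have h1 := hn (2 * π) trivial
  simp only [ofReal_zero, zero_mul, exp_zero, ofReal_mul, ofReal_ofNat, exp_two_pi_mul_I] at h0 h1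
  rw [h0] at h1
  have : (2 * π * I : ℂ) = 0 := by linear_combination -h1
  simp [Real.pi_ne_zero] at this

theorem continuousOn_log_one_sub_div {h k : ℂ → ℂ} {s : Set ℂ} (hh : ContinuousOn h s)
    (hk : ContinuousOn k s) (hlt : ∀ w ∈ s, ‖h w‖ < ‖k w‖) :
    ContinuousOn (fun w => log (1 - h w / k w)) s ∧
      ∀ w ∈ s, exp (log (1 - h w / k w)) = 1 - h w / k w := by
  have hk0 : ∀ w ∈ s, 0 < ‖k w‖ := fun w hw => (norm_nonneg _).trans_lt (hlt w hw)
  have hmem : ∀ w ∈ s, 1 - h w / k w ∈ slitPlane := fun w hw => by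
    rw [sub_eq_add_neg]
    refine mem_slitPlane_of_norm_lt_one ?_
    rw [norm_neg, norm_div, div_lt_one (hk0 w hw)]
    exact hlt w hw
  exact ⟨(continuousOn_const.sub (hh.div hk fun w hw => norm_pos_iff.1 (hk0 w hw))).clog hmem,
    fun w hw => exp_log (slitPlane_ne_zero (hmem w hw))⟩

theorem IsNearlyConformal.exists_log_slope {h : ℂ → ℂ} {W : Set ℂ} {R : ℝ}
    (H : IsNearlyConformal h W R) {w₀ : ℂ} (hw₀ : w₀ ∈ W) :
    ∃ k : ℂ → ℂ, Continuous k ∧ ∀ w, h w - h w₀ = (w - w₀) * exp (k w) := by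
  have hd : DifferentiableAt ℂ h w₀ := H.differentiableOn.differentiableAt
    (H.isOpen.mem_nhds hw₀)
  have hc : Continuous (dslope h w₀) := by
    rw [← continuousOn_univ, continuousOn_dslope univ_mem]
    exact ⟨H.contDiff.continuous.continuousOn, hd⟩
  obtain ⟨k, hk, hke⟩ := exists_continuous_log hc fun w => by
    by_cases hw : w = w₀
    · rw [hw, dslope_same]; exact H.deriv_ne_zero w₀ hw₀
    · rw [dslope_of_ne _ hw, slope_def_field]
      exact div_ne_zero (sub_ne_zero.2 fun h' => hw (H.inj w₀ hw₀ w h')) (sub_ne_zero.2 hw)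
  refine ⟨k, hk, fun w => ?_⟩
  rw [hke, ← smul_eq_mul, sub_smul_dslope]

theorem IsNearlyConformal.exists_log {h : ℂ → ℂ} {W : Set ℂ} {R : ℝ}
    (H : IsNearlyConformal h W R) (r : ℝ) :
    ∃ t₀ > 0, ∃ k : ℂ → ℂ, ContinuousOn k {w | t₀ ≤ ‖w‖} ∧
      ∀ w, t₀ ≤ ‖w‖ → r ≤ ‖h w‖ ∧ h w = w * exp (k w) := by
  obtain ⟨w₀, hw₀⟩ := H.nonempty
  obtain ⟨k, hk, hke⟩ := H.exists_log_slope hw₀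
  have hev : ∀ᶠ w in cocompact ℂ, max r (‖h w₀‖ + 1) ≤ ‖h w‖ :=
    (tendsto_norm_cocompact_atTop.comp H.tendsto).eventually_ge_atTop _
  obtain ⟨ρ, hρ⟩ := eventually_cocompact_iff.1 hev
  obtain ⟨t₀, ht₀⟩ := exists_gt (max ρ ‖w₀‖)
  have hlt : ∀ w : ℂ, t₀ ≤ ‖w‖ → ρ < ‖w‖ ∧ ‖w₀‖ < ‖w‖ := fun w hw =>
    max_lt_iff.1 (ht₀.trans_le hw)
  have hh : ∀ w, t₀ ≤ ‖w‖ → ‖h w₀‖ < ‖h w‖ := fun w hw => by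
    have := (le_max_right r (‖h w₀‖ + 1)).trans (hρ w (hlt w hw).1)
    linarith
  obtain ⟨c1, e1⟩ := continuousOn_log_one_sub_div (h := fun _ => w₀) (k := fun w => w)
    (s := {w | t₀ ≤ ‖w‖}) continuousOn_const continuousOn_id fun w hw => (hlt w hw).2
  obtain ⟨c2, e2⟩ := continuousOn_log_one_sub_div (h := fun _ => h w₀) (k := h)
    (s := {w | t₀ ≤ ‖w‖}) continuousOn_const H.contDiff.continuous.continuousOn hh
  have ht : 0 < t₀ := (norm_nonneg w₀).trans_lt ((le_max_right _ _).trans_lt ht₀)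
  refine ⟨t₀, ht, fun w => log (1 - w₀ / w) + k w - log (1 - h w₀ / h w),
    (c1.add hk.continuousOn).sub c2, fun w hw =>
    ⟨(le_max_left _ _).trans (hρ w (hlt w hw).1), ?_⟩⟩
  have hw0 : w ≠ 0 := norm_pos_iff.1 (ht.trans_le hw)
  have hhw0 : h w ≠ 0 := norm_pos_iff.1 ((norm_nonneg _).trans_lt (hh w hw))
  have hne : h w - h w₀ ≠ 0 := sub_ne_zero.2 fun h' => by
    have := hh w hw; rw [h'] at this; exact lt_irrefl _ this
  rw [exp_sub, exp_add, e1 w hw, e2 w hw, eq_comm]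
  have : 1 - h w₀ / h w ≠ 0 := by
    rw [one_sub_div hhw0]; exact div_ne_zero hne hhw0
  rw [← mul_div_assoc, div_eq_iff this]
  have h2 := hke w
  field_simp
  linear_combination -h2

theorem IsNearlyConformal.exists_sphere_ge {h : ℂ → ℂ} {W : Set ℂ} {R : ℝ}
    (H : IsNearlyConformal h W R) {w₀ : ℂ} (hw₀ : w₀ ∈ W) {t : ℝ} (ht : ‖w₀‖ < t) :
    ∃ w, ‖w‖ = t ∧ ‖h w₀‖ ≤ ‖h w‖ := by
  by_contra! hcon
  obtain ⟨k, hk, hke⟩ := H.exists_log_slope hw₀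
  have hs : ∀ w ∈ sphere (0 : ℂ) t, ‖w‖ = t := fun w hw => by simpa using hw
  have ht0 : 0 < t := (norm_nonneg _).trans_lt ht
  obtain ⟨c1, e1⟩ := continuousOn_log_one_sub_div (h := fun _ => w₀) (k := fun w => w)
    (s := sphere 0 t) continuousOn_const continuousOn_id fun w hw => by rw [hs w hw]; exact ht
  obtain ⟨c2, e2⟩ := continuousOn_log_one_sub_div (h := h) (k := fun _ => h w₀)
    (s := sphere 0 t) H.contDiff.continuous.continuousOn continuousOn_const
    fun w hw => hcon w (hs w hw)
  refine not_exists_continuousOn_log_sphere ht0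
    (m := fun w => log (-h w₀) + log (1 - h w / h w₀) - k w - log (1 - w₀ / w))
    (((continuousOn_const.add c2).sub hk.continuousOn).sub c1) fun w hw => ?_
  have hw0 : w ≠ 0 := norm_pos_iff.1 (by rw [hs w hw]; exact ht0)
  have hhw0 : h w₀ ≠ 0 := norm_pos_iff.1 ((norm_nonneg _).trans_lt (hcon w (hs w hw)))
  have hne : w - w₀ ≠ 0 := sub_ne_zero.2 fun h' => by
    have := hs w hw; rw [h'] at this; exact ht.ne this
  rw [exp_sub, exp_sub, exp_add, e1 w hw, e2 w hw, exp_log (neg_ne_zero.2 hhw0)]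
  have : 1 - w₀ / w ≠ 0 := by
    rw [one_sub_div hw0]; exact div_ne_zero hne hw0
  rw [div_eq_iff this, div_eq_iff (exp_ne_zero _)]
  have h2 := hke w
  field_simp
  linear_combination h2

theorem IsNearlyConformal.exists_sphere_le {h : ℂ → ℂ} {W : Set ℂ} {R : ℝ}
    (H : IsNearlyConformal h W R) {w₀ : ℂ} (hw₀ : w₀ ∈ W) {t : ℝ} (ht0 : 0 < t)
    (ht : t < ‖w₀‖) {l : ℂ → ℂ} (hl : ContinuousOn l (sphere 0 t))
    (hle : ∀ w ∈ sphere (0 : ℂ) t, h w = w * exp (l w)) :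
    ∃ w, ‖w‖ = t ∧ ‖h w‖ ≤ ‖h w₀‖ := by
  by_contra! hcon
  obtain ⟨k, hk, hke⟩ := H.exists_log_slope hw₀
  have hs : ∀ w ∈ sphere (0 : ℂ) t, ‖w‖ = t := fun w hw => by simpa using hw
  obtain ⟨c1, e1⟩ := continuousOn_log_one_sub_div (h := fun w => w) (k := fun _ => w₀)
    (s := sphere 0 t) continuousOn_id continuousOn_const fun w hw => by rw [hs w hw]; exact ht
  obtain ⟨c2, e2⟩ := continuousOn_log_one_sub_div (h := fun _ => h w₀) (k := h)
    (s := sphere 0 t) continuousOn_const H.contDiff.continuous.continuousOn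
    fun w hw => hcon w (hs w hw)
  refine not_exists_continuousOn_log_sphere ht0
    (m := fun w => log (-w₀) + log (1 - w / w₀) + k w - log (1 - h w₀ / h w) - l w)
    ((((continuousOn_const.add c1).add hk.continuousOn).sub c2).sub hl) fun w hw => ?_
  have hw₀0 : w₀ ≠ 0 := norm_pos_iff.1 (ht0.trans ht)
  have hhw0 : h w ≠ 0 := norm_pos_iff.1 ((norm_nonneg _).trans_lt (hcon w (hs w hw)))
  have hne : h w - h w₀ ≠ 0 := sub_ne_zero.2 fun h' => by
    have := hcon w (hs w hw); rw [h'] at this; exact lt_irrefl _ this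
  rw [exp_sub, exp_sub, exp_add, exp_add, e1 w hw, e2 w hw, exp_log (neg_ne_zero.2 hw₀0)]
  have : 1 - h w₀ / h w ≠ 0 := by
    rw [one_sub_div hhw0]; exact div_ne_zero hne hhw0
  rw [div_eq_iff (exp_ne_zero _), ← hle w hw, div_eq_iff this]
  have h2 := hke w
  field_simp
  linear_combination -h2

theorem hasDerivAt_of_exp_eq {η γ : ℝ → ℂ} {γ' : ℂ} {x : ℝ} (hη : ContinuousAt η x)
    (hγ : HasDerivAt γ γ' x) (he : ∀ᶠ y in 𝓝 x, exp (η y) = γ y) :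
    HasDerivAt η (γ' / γ x) x := by
  have hγ0 : γ x ≠ 0 := by rw [← he.self_of_nhds]; exact exp_ne_zero _
  have hlog : HasDerivAt (fun y => η x + log (γ y / γ x)) (γ' / γ x / (γ x / γ x)) x := by
    refine HasDerivAt.const_add _ (HasDerivAt.clog_real (hγ.div_const _) ?_)
    rw [div_self hγ0]; exact one_mem_slitPlane
  rw [div_self hγ0, div_one] at hlog
  refine hlog.congr_of_eventuallyEq ?_
  have hsmall : ∀ᶠ y in 𝓝 x, dist (η y) (η x) < π := Metric.tendsto_nhds.1 hη π Real.pi_pos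
  filter_upwards [he, hsmall] with y hy hd
  rw [dist_eq] at hd
  have him : |(η y - η x).im| < π := (abs_im_le_norm _).trans_lt hd
  rw [← hy, ← he.self_of_nhds, ← exp_sub, log_exp (abs_lt.1 him).1 (abs_lt.1 him).2.le]
  ring

/-- The norm of the derivative of `h` in logarithmic coordinates. -/
noncomputable def logDilation (h : ℂ → ℂ) (w : ℂ) : ℝ :=
  ‖fderiv ℝ h w‖ * ‖w‖ / max ‖h w‖ 1

theorem logDilation_nonneg (h : ℂ → ℂ) (w : ℂ) : 0 ≤ logDilation h w := by
  unfold logDilation; positivity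

theorem continuous_logDilation {h : ℂ → ℂ} (hh : ContDiff ℝ 1 h) : Continuous (logDilation h) := by
  have h1 := hh.continuous_fderiv one_ne_zero
  have h2 := hh.continuous
  refine (h1.norm.mul continuous_norm).div (h2.norm.max continuous_const) fun w => ?_
  have : 0 < max ‖h w‖ 1 := lt_max_of_lt_right one_pos
  exact this.ne'

theorem norm_sub_le_integral_logDilation {h : ℂ → ℂ} (hh : ContDiff ℝ 1 h) {a b : ℂ}
    (hb : ‖b‖ = 1) {x₁ x₂ : ℝ} (hx : x₁ ≤ x₂) {η : ℝ → ℂ} (hη : ContinuousOn η (Icc x₁ x₂))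
    (he : ∀ x ∈ Icc x₁ x₂, exp (η x) = h (exp (a + x * b)))
    (h1 : ∀ x ∈ Icc x₁ x₂, 1 ≤ ‖h (exp (a + x * b))‖) :
    ‖η x₂ - η x₁‖ ≤ ∫ x in x₁..x₂, logDilation h (exp (a + x * b)) := by
  have hc : Continuous fun x : ℝ => exp (a + x * b) := by fun_prop
  have hdc : ∀ x : ℝ, HasDerivAt (fun x : ℝ => exp (a + x * b)) (exp (a + x * b) * b) x := by
    intro x
    have : HasDerivAt (fun x : ℝ => a + x * b) b x := by
      simpa using ((hasDerivAt_id x).ofReal_comp.mul_const b).const_add a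
    exact this.cexp
  have hdγ : ∀ x : ℝ, HasDerivAt (fun x : ℝ => h (exp (a + x * b)))
      (fderiv ℝ h (exp (a + x * b)) (exp (a + x * b) * b)) x := fun x =>
    ((hh.differentiable one_ne_zero _).hasFDerivAt).comp_hasDerivAt x (hdc x)
  obtain ⟨η', hη'⟩ : ∃ η' : ℝ → ℂ, ∀ x, η' x =
      fderiv ℝ h (exp (a + x * b)) (exp (a + x * b) * b) / h (exp (a + x * b)) :=
    ⟨_, fun _ => rfl⟩
  have hη'c : ContinuousOn η' (Icc x₁ x₂) := by
    have hfd : Continuous (fderiv ℝ h) := hh.continuous_fderiv one_ne_zero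
    rw [funext hη']
    refine ContinuousOn.div ?_ (hh.continuous.comp hc).continuousOn fun x hx =>
      norm_pos_iff.1 (one_pos.trans_le (h1 x hx))
    exact ((hfd.comp hc).clm_apply (hc.mul continuous_const)).continuousOn
  have hdη : ∀ x ∈ Ioo x₁ x₂, HasDerivAt η (η' x) x := fun x hx => by
    have hev : ∀ᶠ y in 𝓝 x, exp (η y) = h (exp (a + y * b)) :=
      eventually_of_mem (Icc_mem_nhds hx.1 hx.2) he
    have := hasDerivAt_of_exp_eq (hη.continuousAt (Icc_mem_nhds hx.1 hx.2)) (hdγ x) hev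
    rwa [hη']
  have hint := intervalIntegral.integral_eq_sub_of_hasDerivAt_of_le hx hη (f' := η')
    hdη (hη'c.intervalIntegrable_of_Icc hx)
  have hLc : Continuous fun x : ℝ => logDilation h (exp (a + x * b)) :=
    (continuous_logDilation hh).comp hc
  have hi1 : IntervalIntegrable (fun x => ‖η' x‖) volume x₁ x₂ :=
    hη'c.norm.intervalIntegrable_of_Icc hx
  have hi2 : IntervalIntegrable (fun x : ℝ => logDilation h (exp (a + x * b))) volume x₁ x₂ :=
    hLc.intervalIntegrable _ _
  rw [← hint]
  refine (intervalIntegral.norm_integral_le_integral_norm hx).trans ?_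
  refine intervalIntegral.integral_mono_on hx hi1 hi2 fun x hx => ?_
  rw [hη', logDilation, norm_div, max_eq_left (h1 x hx)]
  gcongr
  refine (ContinuousLinearMap.le_opNorm _ _).trans (le_of_eq ?_)
  rw [norm_mul, hb, mul_one]

theorem lintegral_annulus {φ : ℂ → ℝ≥0∞} (hφ : Measurable φ) (a b : ℝ) :
    ∫⁻ z in norm ⁻¹' Ioo (Real.exp a) (Real.exp b), φ z =
      ∫⁻ σ in Ioo a b, ENNReal.ofReal (Real.exp σ ^ 2) *
        ∫⁻ θ in Ioo (-π) π, φ (exp (σ + θ * I)) := by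
  rw [lintegral_norm_preimage measurableSet_Ioo hφ]
  have himg : Ioi 0 ∩ Ioo (Real.exp a) (Real.exp b) = Real.exp '' Ioo a b := by
    ext r
    constructor
    · rintro ⟨h0, h1, h2⟩
      exact ⟨Real.log r, ⟨(Real.lt_log_iff_exp_lt h0).2 h1, (Real.log_lt_iff_lt_exp h0).2 h2⟩,
        Real.exp_log h0⟩
    · rintro ⟨σ, hσ, rfl⟩
      exact ⟨Real.exp_pos σ, Real.exp_lt_exp.2 hσ.1, Real.exp_lt_exp.2 hσ.2⟩
  rw [himg, lintegral_image_eq_lintegral_abs_deriv_mul measurableSet_Ioo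
    (fun x _ => (Real.hasDerivAt_exp x).hasDerivWithinAt) Real.exp_injective.injOn]
  congr 1 with σ
  rw [abs_of_pos (Real.exp_pos σ), ← mul_assoc, ← ENNReal.ofReal_mul (Real.exp_pos σ).le, ← sq]
  congr 2 with θ
  rw [exp_add, ofReal_exp]

theorem lintegral_annulus_inv_sq (a b : ℝ) :
    ∫⁻ z : ℂ in norm ⁻¹' Ioo (Real.exp a) (Real.exp b), ENNReal.ofReal (1 / ‖z‖ ^ 2) =
      ENNReal.ofReal (2 * π * (b - a)) := by
  rw [lintegral_annulus (by fun_prop)]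
  have : ∀ σ ∈ Ioo a b, ENNReal.ofReal (Real.exp σ ^ 2) * ∫⁻ θ in Ioo (-π) π,
      ENNReal.ofReal (1 / ‖exp ((σ : ℂ) + θ * I)‖ ^ 2) = ENNReal.ofReal (2 * π) := fun σ _ => by
    have h1 : ∀ θ : ℝ, ‖exp ((σ : ℂ) + θ * I)‖ = Real.exp σ := fun θ => by
      rw [norm_exp]; simp
    simp_rw [h1]
    rw [setLIntegral_const, Real.volume_Ioo, ← mul_assoc, ← ENNReal.ofReal_mul (by positivity),
      mul_one_div_cancel (by positivity), ENNReal.ofReal_one, one_mul]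
    congr 1; ring
  rw [setLIntegral_congr_fun measurableSet_Ioo this, setLIntegral_const, Real.volume_Ioo,
    ← ENNReal.ofReal_mul (by positivity)]

/-- The logarithmic energy of `h` on the circle of radius `exp s`. -/
noncomputable def circleEnergy (h : ℂ → ℂ) (s : ℝ) : ℝ :=
  ∫ θ in (-π)..π, logDilation h (exp (s + θ * I)) ^ 2

theorem continuous_logDilation_exp {h : ℂ → ℂ} (hh : ContDiff ℝ 1 h) :
    Continuous fun p : ℝ × ℝ => logDilation h (exp (p.1 + p.2 * I)) :=
  (continuous_logDilation hh).comp (by fun_prop)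

theorem continuous_logDilation_exp_right {h : ℂ → ℂ} (hh : ContDiff ℝ 1 h) (s : ℝ) :
    Continuous fun θ : ℝ => logDilation h (exp (s + θ * I)) :=
  (continuous_logDilation hh).comp (by fun_prop)

theorem continuous_circleEnergy {h : ℂ → ℂ} (hh : ContDiff ℝ 1 h) :
    Continuous (circleEnergy h) := by
  refine intervalIntegral.continuous_parametric_intervalIntegral_of_continuous' ?_ _ _
  exact (continuous_logDilation_exp hh).pow 2

theorem norm_exp_add_mul_I (s θ : ℝ) : ‖exp ((s : ℂ) + θ * I)‖ = Real.exp s := by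
  rw [norm_exp]; simp

theorem exists_eq_exp_add_mul_I {w : ℂ} {s : ℝ} (hw : ‖w‖ = Real.exp s) :
    ∃ θ ∈ Icc (-π) π, w = exp ((s : ℂ) + θ * I) := by
  refine ⟨arg w, ⟨(neg_pi_lt_arg w).le, arg_le_pi w⟩, ?_⟩
  rw [exp_add, ← ofReal_exp, ← hw, norm_mul_exp_arg_mul_I]

theorem norm_log_sub_le_integral_angular {h k : ℂ → ℂ} {s₀ : ℝ} (hh : ContDiff ℝ 1 h)
    (hk : ContinuousOn k {w | Real.exp s₀ ≤ ‖w‖})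
    (hke : ∀ w, Real.exp s₀ ≤ ‖w‖ → 1 ≤ ‖h w‖ ∧ h w = w * exp (k w))
    {s : ℝ} (hs : s₀ ≤ s) {θ₁ θ₂ : ℝ} (hθ : θ₁ ≤ θ₂) :
    ‖((s + θ₂ * I + k (exp (s + θ₂ * I))) - (s + θ₁ * I + k (exp (s + θ₁ * I))) : ℂ)‖ ≤
      ∫ θ in θ₁..θ₂, logDilation h (exp (s + θ * I)) := by
  have hmem : ∀ θ : ℝ, Real.exp s₀ ≤ ‖exp ((s : ℂ) + θ * I)‖ := fun θ => by
    rw [norm_exp_add_mul_I]; exact Real.exp_le_exp.2 hs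
  refine norm_sub_le_integral_logDilation hh (a := s) (b := I) (by simp) hθ
    (η := fun θ : ℝ => (s : ℂ) + θ * I + k (exp (s + θ * I))) ?_ ?_ ?_
  · exact ContinuousOn.add (by fun_prop) (hk.comp (by fun_prop) fun θ _ => hmem θ)
  · intro θ _
    rw [exp_add _ (k _), (hke _ (hmem θ)).2]
  · intro θ _; exact (hke _ (hmem θ)).1

theorem re_log_eq {h k : ℂ → ℂ} {ζ : ℂ} (hζ : h (exp ζ) = exp ζ * exp (k (exp ζ))) :
    (ζ + k (exp ζ)).re = Real.log ‖h (exp ζ)‖ := by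
  rw [hζ, ← exp_add, norm_exp, Real.log_exp]

theorem circle_oscillation {h k : ℂ → ℂ} {s₀ : ℝ} (hh : ContDiff ℝ 1 h)
    (hk : ContinuousOn k {w | Real.exp s₀ ≤ ‖w‖})
    (hke : ∀ w, Real.exp s₀ ≤ ‖w‖ → 1 ≤ ‖h w‖ ∧ h w = w * exp (k w))
    {s : ℝ} (hs : s₀ ≤ s) :
    2 * π ≤ circleEnergy h s ∧
      ∀ w w', ‖w‖ = Real.exp s → ‖w'‖ = Real.exp s →
        (Real.log ‖h w‖ - Real.log ‖h w'‖) ^ 2 ≤ 2 * π * circleEnergy h s := by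
  set P : ℝ → ℝ := fun θ => logDilation h (exp (s + θ * I)) with hP
  have hPc : Continuous P := continuous_logDilation_exp_right hh s
  have hP0 : ∀ θ, 0 ≤ P θ := fun θ => logDilation_nonneg _ _
  have hint : ∀ a b, IntervalIntegrable P volume a b := fun a b => hPc.intervalIntegrable a b
  set J := ∫ θ in (-π)..π, P θ with hJ
  have hpi := Real.pi_pos
  have hCS : J ^ 2 ≤ 2 * π * circleEnergy h s := by
    have h0 : 0 ≤ ∫ θ in (-π)..π, (P θ - J / (2 * π)) ^ 2 :=
      intervalIntegral.integral_nonneg (by linarith) fun θ _ => sq_nonneg _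
    have e : ∀ θ, (P θ - J / (2 * π)) ^ 2 = P θ ^ 2 - (J / π) * P θ + (J / (2 * π)) ^ 2 := by
      intro θ; field_simp; ring
    simp_rw [e] at h0
    rw [intervalIntegral.integral_add, intervalIntegral.integral_sub,
      intervalIntegral.integral_const_mul, intervalIntegral.integral_const, smul_eq_mul,
      ← hJ] at h0
    · have e2 : (∫ θ in (-π)..π, P θ ^ 2) = circleEnergy h s := rfl
      rw [e2] at h0
      have e3 : circleEnergy h s - J / π * J + (π - -π) * (J / (2 * π)) ^ 2 =
        circleEnergy h s - J ^ 2 / (2 * π) := by field_simp; ring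
      rw [e3, sub_nonneg, div_le_iff₀ (by positivity)] at h0
      linarith
    · exact (hPc.pow 2).intervalIntegrable _ _
    · exact (continuous_const.mul hPc).intervalIntegrable _ _
    · exact ((hPc.pow 2).sub (continuous_const.mul hPc)).intervalIntegrable _ _
    · exact continuous_const.intervalIntegrable _ _
  have h2pi : 2 * π ≤ J := by
    have h1 := norm_log_sub_le_integral_angular hh hk hke hs (show -π ≤ π by linarith)
    have e1 : exp ((s : ℂ) + (π : ℝ) * I) = exp ((s : ℂ) + ((-π : ℝ) : ℂ) * I) := by
      rw [exp_eq_exp_iff_exists_int]; exact ⟨1, by push_cast; ring⟩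
    rw [e1] at h1
    have e2 : ((s : ℂ) + π * I + k (exp (s + ((-π : ℝ) : ℂ) * I)) -
      (s + ((-π : ℝ) : ℂ) * I + k (exp (s + ((-π : ℝ) : ℂ) * I)))) = ((2 * π : ℝ) : ℂ) * I := by
      push_cast; ring
    rw [e2, norm_mul, norm_I, mul_one, norm_real, Real.norm_eq_abs,
      abs_of_pos (by positivity)] at h1
    exact h1
  refine ⟨?_, ?_⟩
  · have : (2 * π) * (2 * π) ≤ 2 * π * circleEnergy h s := by nlinarith
    exact le_of_mul_le_mul_left this (by positivity)
  · intro w w' hw hw'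
    obtain ⟨θ, hθ, rfl⟩ := exists_eq_exp_add_mul_I hw
    obtain ⟨θ', hθ', rfl⟩ := exists_eq_exp_add_mul_I hw'
    have key : ∀ a b : ℝ, a ∈ Icc (-π) π → b ∈ Icc (-π) π → a ≤ b →
        |Real.log ‖h (exp (s + b * I))‖ - Real.log ‖h (exp (s + a * I))‖| ≤ J := by
      intro a b ha hb hab
      have h1 := norm_log_sub_le_integral_angular hh hk hke hs hab
      have hm : ∀ x : ℝ, Real.exp s₀ ≤ ‖exp ((s : ℂ) + x * I)‖ := fun x => by
        rw [norm_exp_add_mul_I]; exact Real.exp_le_exp.2 hs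
      rw [← re_log_eq (hke _ (hm a)).2, ← re_log_eq (hke _ (hm b)).2, ← sub_re]
      refine (abs_re_le_norm _).trans (h1.trans ?_)
      exact intervalIntegral.integral_mono_interval ha.1 hab hb.2
        (Filter.Eventually.of_forall hP0) (hint _ _)
    have habs : |Real.log ‖h (exp (s + θ * I))‖ - Real.log ‖h (exp (s + θ' * I))‖| ≤ J := by
      rcases le_total θ θ' with hl | hl
      · rw [abs_sub_comm]; exact key _ _ hθ hθ' hl
      · exact key _ _ hθ' hθ hl
    refine le_trans ?_ hCS
    exact sq_le_sq.2 (habs.trans (le_abs_self _))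

theorem log_norm_radial_le {h k : ℂ → ℂ} {s₀ : ℝ} (hh : ContDiff ℝ 1 h)
    (hk : ContinuousOn k {w | Real.exp s₀ ≤ ‖w‖})
    (hke : ∀ w, Real.exp s₀ ≤ ‖w‖ → 1 ≤ ‖h w‖ ∧ h w = w * exp (k w))
    {s : ℝ} (hs : s₀ ≤ s) (θ : ℝ) :
    Real.log ‖h (exp (s + θ * I))‖ - Real.log ‖h (exp (s₀ + θ * I))‖ ≤
      ∫ σ in s₀..s, logDilation h (exp (σ + θ * I)) := by
  have hm : ∀ x : ℝ, s₀ ≤ x → Real.exp s₀ ≤ ‖exp ((x : ℂ) + θ * I)‖ := fun x hx => by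
    rw [norm_exp_add_mul_I]; exact Real.exp_le_exp.2 hx
  have h1 := norm_sub_le_integral_logDilation hh (a := θ * I) (b := 1) (by simp) hs
    (η := fun σ : ℝ => (σ : ℂ) + θ * I + k (exp (σ + θ * I))) ?_ ?_ ?_
  · rw [← re_log_eq (hke _ (hm s hs)).2, ← re_log_eq (hke _ (hm s₀ le_rfl)).2, ← sub_re]
    refine (re_le_norm _).trans (h1.trans (le_of_eq ?_))
    refine intervalIntegral.integral_congr fun σ _ => ?_
    simp only [mul_one, add_comm]
  · exact ContinuousOn.add (by fun_prop) (hk.comp (by fun_prop) fun σ hσ => hm σ hσ.1)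
  · intro σ hσ
    rw [exp_add _ (k _), ← (hke _ (hm σ hσ.1)).2, mul_one, add_comm]
  · intro σ hσ
    rw [mul_one, add_comm]; exact (hke _ (hm σ hσ.1)).1

theorem min_log_norm_le {h k : ℂ → ℂ} {s₀ : ℝ} (hh : ContDiff ℝ 1 h)
    (hk : ContinuousOn k {w | Real.exp s₀ ≤ ‖w‖})
    (hke : ∀ w, Real.exp s₀ ≤ ‖w‖ → 1 ≤ ‖h w‖ ∧ h w = w * exp (k w))
    {s : ℝ} (hs : s₀ ≤ s) {m M : ℝ} (hm : ∀ w, ‖w‖ = Real.exp s → m ≤ Real.log ‖h w‖)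
    (hM : ∀ w, ‖w‖ = Real.exp s₀ → Real.log ‖h w‖ ≤ M) :
    m ≤ M + ((∫ σ in s₀..s, circleEnergy h σ / (2 * π)) + (s - s₀)) / 2 := by
  have hpi := Real.pi_pos
  have hP2 : Continuous fun p : ℝ × ℝ => logDilation h (exp (p.2 + p.1 * I)) ^ 2 := by
    have hc : Continuous fun p : ℝ × ℝ => exp ((p.2 : ℂ) + p.1 * I) := by fun_prop
    exact ((continuous_logDilation hh).comp hc).pow 2
  have hθ : ∀ θ : ℝ, m - M ≤
      ((∫ σ in s₀..s, logDilation h (exp (σ + θ * I)) ^ 2) + (s - s₀)) / 2 := by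
    intro θ
    have h1 := log_norm_radial_le hh hk hke hs θ
    have h2 := hm _ (norm_exp_add_mul_I s θ)
    have h3 := hM _ (norm_exp_add_mul_I s₀ θ)
    have hc : Continuous fun σ : ℝ => logDilation h (exp (σ + θ * I)) :=
      (continuous_logDilation hh).comp (by fun_prop)
    have hc2 : Continuous fun σ : ℝ => logDilation h (exp (σ + θ * I)) ^ 2 := hc.pow 2
    have h4 : ∫ σ in s₀..s, logDilation h (exp (σ + θ * I)) ≤
        ∫ σ in s₀..s, (logDilation h (exp (σ + θ * I)) ^ 2 + 1) / 2 := by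
      refine intervalIntegral.integral_mono_on hs (hc.intervalIntegrable _ _)
        ((((hc.pow 2).add continuous_const).div_const _).intervalIntegrable _ _) fun σ _ => ?_
      nlinarith [sq_nonneg (logDilation h (exp (σ + θ * I)) - 1)]
    rw [intervalIntegral.integral_div, intervalIntegral.integral_add
      (hc2.intervalIntegrable _ _) (continuous_const.intervalIntegrable _ _),
      intervalIntegral.integral_const, smul_eq_mul, mul_one] at h4
    linarith
  have hswap : (∫ θ in (-π)..π, ∫ σ in s₀..s, logDilation h (exp (σ + θ * I)) ^ 2) =
      ∫ σ in s₀..s, circleEnergy h σ := by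
    unfold circleEnergy
    refine intervalIntegral_intervalIntegral_swap ?_
    exact (hP2.continuousOn.integrableOn_compact
      (isCompact_uIcc.prod isCompact_uIcc)).mono_set
      (Set.prod_mono uIoc_subset_uIcc uIoc_subset_uIcc)
  have hcont : Continuous fun θ : ℝ => ∫ σ in s₀..s, logDilation h (exp (σ + θ * I)) ^ 2 :=
    intervalIntegral.continuous_parametric_intervalIntegral_of_continuous'
      (f := fun (θ σ : ℝ) => logDilation h (exp (σ + θ * I)) ^ 2) hP2 _ _
  have h5 : ∫ _θ in (-π)..π, (m - M) ≤ ∫ θ in (-π)..π,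
      ((∫ σ in s₀..s, logDilation h (exp (σ + θ * I)) ^ 2) + (s - s₀)) / 2 :=
    intervalIntegral.integral_mono_on (by linarith) (continuous_const.intervalIntegrable _ _)
      (((hcont.add continuous_const).div_const _).intervalIntegrable _ _) fun θ _ => hθ θ
  rw [intervalIntegral.integral_div, intervalIntegral.integral_add
      (hcont.intervalIntegrable _ _) (continuous_const.intervalIntegrable _ _), hswap,
      intervalIntegral.integral_const, intervalIntegral.integral_const, smul_eq_mul,
      smul_eq_mul] at h5
  rw [intervalIntegral.integral_div]
  have h6 : (m - M) * (2 * π) ≤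
      (((∫ σ in s₀..s, circleEnergy h σ) / (2 * π) + (s - s₀)) / 2) * (2 * π) := by
    have : (((∫ σ in s₀..s, circleEnergy h σ) / (2 * π) + (s - s₀)) / 2) * (2 * π) =
      ((∫ σ in s₀..s, circleEnergy h σ) + (π - -π) * (s - s₀)) / 2 := by field_simp; ring
    rw [this]; linarith
  have := le_of_mul_le_mul_right h6 (by positivity)
  linarith

theorem ofReal_integral_eq_lintegral_Ioo {u : ℝ → ℝ} (hu : Continuous u) (h0 : ∀ x, 0 ≤ u x)
    {a b : ℝ} (hab : a ≤ b) :
    ENNReal.ofReal (∫ x in a..b, u x) = ∫⁻ x in Ioo a b, ENNReal.ofReal (u x) := by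
  rw [intervalIntegral.integral_of_le hab, integral_Ioc_eq_integral_Ioo]
  refine ofReal_integral_eq_lintegral_ofReal ?_ (Filter.Eventually.of_forall h0)
  exact (hu.continuousOn.integrableOn_Icc (a := a) (b := b)).mono_set Ioo_subset_Icc_self

theorem circleEnergy_nonneg (h : ℂ → ℂ) (s : ℝ) : 0 ≤ circleEnergy h s :=
  intervalIntegral.integral_nonneg (by linarith [Real.pi_pos]) fun _ _ => sq_nonneg _

theorem ofReal_integral_circleEnergy {h : ℂ → ℂ} (hh : ContDiff ℝ 1 h) {a b : ℝ} (hab : a ≤ b) :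
    ENNReal.ofReal (∫ σ in a..b, circleEnergy h σ) =
      ∫⁻ w in norm ⁻¹' Ioo (Real.exp a) (Real.exp b),
        ENNReal.ofReal ((‖fderiv ℝ h w‖ / max ‖h w‖ 1) ^ 2) := by
  have h1 := hh.continuous_fderiv one_ne_zero
  have h2 := hh.continuous
  have hc : Continuous fun w => ‖fderiv ℝ h w‖ / max ‖h w‖ 1 :=
    h1.norm.div (h2.norm.max continuous_const) fun w => (lt_max_of_lt_right one_pos).ne'
  have hc2 : Continuous fun w => (‖fderiv ℝ h w‖ / max ‖h w‖ 1) ^ 2 := hc.pow 2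
  rw [lintegral_annulus hc2.measurable.ennreal_ofReal,
    ofReal_integral_eq_lintegral_Ioo (continuous_circleEnergy hh) (circleEnergy_nonneg h) hab]
  refine setLIntegral_congr_fun measurableSet_Ioo fun σ _ => ?_
  have hP : Continuous fun θ : ℝ => logDilation h (exp (σ + θ * I)) ^ 2 :=
    (continuous_logDilation_exp_right hh σ).pow 2
  unfold circleEnergy
  rw [ofReal_integral_eq_lintegral_Ioo hP (fun _ => sq_nonneg _)
    (by linarith [Real.pi_pos]), ← lintegral_const_mul' _ _ ENNReal.ofReal_ne_top]
  refine setLIntegral_congr_fun measurableSet_Ioo fun θ _ => ?_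
  rw [← ENNReal.ofReal_mul (sq_nonneg _), logDilation, norm_exp_add_mul_I]
  congr 1; ring

theorem norm_fderiv_real_eq_norm_deriv {h : ℂ → ℂ} {w : ℂ} (hw : DifferentiableAt ℂ h w) :
    ‖fderiv ℝ h w‖ = ‖deriv h w‖ := by
  rw [(hw.hasFDerivAt.restrictScalars ℝ).fderiv, ContinuousLinearMap.norm_restrictScalars,
    ← norm_deriv_eq_norm_fderiv]

theorem IsNearlyConformal.exists_integral_circleEnergy_le {h : ℂ → ℂ} {W : Set ℂ} {R : ℝ}
    (H : IsNearlyConformal h W R) {s₀ : ℝ}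
    (hs₀ : ∀ w, Real.exp s₀ ≤ ‖w‖ → 1 ≤ ‖h w‖ ∧ R ≤ ‖h w‖) :
    ∃ C, ∀ s ≥ s₀, ∀ M, (∀ w, ‖w‖ = Real.exp s → Real.log ‖h w‖ ≤ M) →
      ∫ σ in s₀..s, circleEnergy h σ ≤ 2 * π * M + C := by
  set E := ∫⁻ w in Wᶜ ∩ {w | R ≤ ‖h w‖}, ENNReal.ofReal ((‖fderiv ℝ h w‖ / ‖h w‖) ^ 2)
  refine ⟨4 * π + E.toReal, fun s hs M hM => ?_⟩
  have hpi := Real.pi_pos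
  set A : Set ℂ := norm ⁻¹' Ioo (Real.exp s₀) (Real.exp s)
  have hA : MeasurableSet A := measurableSet_Ioo.preimage measurable_norm
  have hA1 : ∀ w ∈ A, 1 ≤ ‖h w‖ ∧ R ≤ ‖h w‖ := fun w hw => hs₀ w hw.1.le
  have hM0 : 0 ≤ M := by
    refine (Real.log_nonneg ?_).trans (hM (Real.exp s) (by simp))
    exact (hs₀ _ (by simpa using hs)).1
  have hWm := H.isOpen.measurableSet
  have hAW : ∫⁻ w in A ∩ W, ENNReal.ofReal ((‖fderiv ℝ h w‖ / max ‖h w‖ 1) ^ 2) ≤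
      ENNReal.ofReal (2 * π * (M + 2)) := by
    have e : ∫⁻ w in A ∩ W, ENNReal.ofReal ((‖fderiv ℝ h w‖ / max ‖h w‖ 1) ^ 2) =
        ∫⁻ z in h '' (A ∩ W), ENNReal.ofReal (1 / ‖z‖ ^ 2) := by
      rw [lintegral_image_holomorphic (hA.inter hWm) (F' := deriv h)
        (fun w hw => (H.differentiableOn.differentiableAt (H.isOpen.mem_nhds hw.2)).hasDerivAt)
        (fun w hw w' _ he => (H.inj w hw.2 w' he.symm).symm)]
      refine setLIntegral_congr_fun (hA.inter hWm) fun w hw => ?_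
      rw [← ENNReal.ofReal_mul (sq_nonneg _), max_eq_left (hA1 w hw.1).1,
        norm_fderiv_real_eq_norm_deriv (H.differentiableOn.differentiableAt
          (H.isOpen.mem_nhds hw.2))]
      congr 1; ring
    rw [e]
    have e2 := lintegral_annulus_inv_sq (-1) (M + 1)
    rw [show M + 1 - -1 = M + 2 by ring] at e2
    rw [← e2]
    refine lintegral_mono_set ?_
    rintro _ ⟨w, hw, rfl⟩
    have h1 := (hA1 w hw.1).1
    refine ⟨lt_of_lt_of_le (by simp) h1, ?_⟩
    obtain ⟨w', hw', hle⟩ := H.exists_sphere_ge hw.2 hw.1.2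
    have h2 := hM w' hw'
    rw [Real.log_le_iff_le_exp (by linarith)] at h2
    exact (hle.trans h2).trans_lt (Real.exp_lt_exp.2 (by linarith))
  have hAWc : ∫⁻ w in A ∩ Wᶜ, ENNReal.ofReal ((‖fderiv ℝ h w‖ / max ‖h w‖ 1) ^ 2) ≤ E := by
    have e : ∫⁻ w in A ∩ Wᶜ, ENNReal.ofReal ((‖fderiv ℝ h w‖ / max ‖h w‖ 1) ^ 2) =
        ∫⁻ w in A ∩ Wᶜ, ENNReal.ofReal ((‖fderiv ℝ h w‖ / ‖h w‖) ^ 2) := by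
      refine setLIntegral_congr_fun (hA.inter hWm.compl) fun w hw => ?_
      rw [max_eq_left (hA1 w hw.1).1]
    rw [e]
    exact lintegral_mono_set fun w hw => ⟨hw.2, (hA1 w hw.1).2⟩
  have hE : E ≠ ⊤ := H.energy.ne
  have key : ENNReal.ofReal (∫ σ in s₀..s, circleEnergy h σ) ≤
      ENNReal.ofReal (2 * π * (M + 2) + E.toReal) := by
    rw [ofReal_integral_circleEnergy H.contDiff hs,
      ENNReal.ofReal_add (by positivity) ENNReal.toReal_nonneg, ENNReal.ofReal_toReal hE,
      ← lintegral_inter_add_sdiff _ A hWm]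
    exact add_le_add hAW hAWc
  have := (ENNReal.ofReal_le_ofReal_iff (by positivity)).1 key
  linarith

theorem IsNearlyConformal.eventually_log_norm {h : ℂ → ℂ} {W : Set ℂ} {R : ℝ}
    (H : IsNearlyConformal h W R) {ε : ℝ} (hε : 0 < ε) :
    ∀ᶠ w in cocompact ℂ, w ∈ W → (1 - ε) * Real.log ‖w‖ ≤ Real.log ‖h w‖ ∧
      Real.log ‖h w‖ ≤ (1 + ε) * Real.log ‖w‖ := by
  have hpi := Real.pi_pos
  obtain ⟨t₀, ht₀, k, hk, hk'⟩ := H.exists_log (max R 1)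
  obtain ⟨s₀, rfl⟩ : ∃ s, Real.exp s = t₀ := ⟨_, Real.exp_log ht₀⟩
  have hke : ∀ w, Real.exp s₀ ≤ ‖w‖ → 1 ≤ ‖h w‖ ∧ h w = w * exp (k w) := fun w hw =>
    ⟨(le_max_right _ _).trans (hk' w hw).1, (hk' w hw).2⟩
  have hR : ∀ w, Real.exp s₀ ≤ ‖w‖ → 1 ≤ ‖h w‖ ∧ R ≤ ‖h w‖ := fun w hw =>
    ⟨(le_max_right _ _).trans (hk' w hw).1, (le_max_left _ _).trans (hk' w hw).1⟩
  have hext : ∀ s ≥ s₀, ∃ a b : ℂ, ‖a‖ = Real.exp s ∧ ‖b‖ = Real.exp s ∧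
      ∀ w, ‖w‖ = Real.exp s → Real.log ‖h a‖ ≤ Real.log ‖h w‖ ∧
        Real.log ‖h w‖ ≤ Real.log ‖h b‖ := by
    intro s hs
    have hcpt := isCompact_sphere (0 : ℂ) (Real.exp s)
    have hne : (sphere (0 : ℂ) (Real.exp s)).Nonempty :=
      NormedSpace.sphere_nonempty.2 (Real.exp_pos s).le
    have hc : ContinuousOn (fun w => Real.log ‖h w‖) (sphere (0 : ℂ) (Real.exp s)) := by
      refine ContinuousOn.log H.contDiff.continuous.norm.continuousOn fun w hw => ?_
      have := (hke w (by rw [mem_sphere_zero_iff_norm.1 hw]; exact Real.exp_le_exp.2 hs)).1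
      linarith
    obtain ⟨a, ha, ha'⟩ := hcpt.exists_isMinOn hne hc
    obtain ⟨b, hb, hb'⟩ := hcpt.exists_isMaxOn hne hc
    exact ⟨a, b, mem_sphere_zero_iff_norm.1 ha, mem_sphere_zero_iff_norm.1 hb, fun w hw =>
      ⟨ha' (mem_sphere_zero_iff_norm.2 hw), hb' (mem_sphere_zero_iff_norm.2 hw)⟩⟩
  choose! a b ha hb hab using hext
  set m := fun s => Real.log ‖h (a s)‖
  set M := fun s => Real.log ‖h (b s)‖
  obtain ⟨C, hC⟩ := H.exists_integral_circleEnergy_le hR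
  set d := fun s => circleEnergy h s / (2 * π) with hd
  set Y := fun s => ∫ σ in s₀..s, d σ with hY
  have hdc : Continuous d := (continuous_circleEnergy H.contDiff).div_const _
  have hrad := exists_radii (d := d) (Y := Y) (M := M) (m := m) (s₀ := s₀)
    (C := max (C / (2 * π)) (M s₀ - s₀ / 2)) (K := 4 * π ^ 2) ?_ ?_ ?_ (by positivity) ?_ ?_ ?_ hε
  · obtain ⟨w₀, hw₀⟩ := H.nonempty
    have hlog : Tendsto (fun w : ℂ => Real.log ‖w‖) (cocompact ℂ) atTop :=
      Real.tendsto_log_atTop.comp tendsto_norm_cocompact_atTop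
    have hpos : ∀ᶠ w in cocompact ℂ, (0 : ℝ) < ‖w‖ :=
      tendsto_norm_cocompact_atTop.eventually_gt_atTop 0
    filter_upwards [hlog.eventually hrad, hpos] with w hw hw0 hwW
    obtain ⟨⟨s', hs', hs₀', hM'⟩, s'', hs'', hs₀'', hm''⟩ := hw
    have hmem : ∀ s ≥ s₀, ∀ v, ‖v‖ = Real.exp s → 1 ≤ ‖h v‖ ∧ h v = v * exp (k v) :=
      fun s hs v hv => hke v (by rw [hv]; exact Real.exp_le_exp.2 hs)
    have hwR : 0 < ‖w‖ := hw0
    constructor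
    · obtain ⟨v, hv, hle⟩ := H.exists_sphere_le hwW (t := Real.exp s'') (l := k)
        (Real.exp_pos _) (by rwa [← Real.lt_log_iff_exp_lt hwR])
        (hk.mono fun v hv => by
          rw [mem_sphere_zero_iff_norm] at hv
          rw [Set.mem_ofPred_eq, hv]; exact Real.exp_le_exp.2 hs₀'')
        (fun v hv => (hmem _ hs₀'' v (mem_sphere_zero_iff_norm.1 hv)).2)
      refine hm''.trans (((hab s'' hs₀'' v hv).1).trans ?_)
      exact Real.log_le_log (by linarith [(hmem _ hs₀'' v hv).1]) hle
    · obtain ⟨v, hv, hle⟩ := H.exists_sphere_ge hwW (t := Real.exp s')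
        (by rwa [← Real.log_lt_iff_lt_exp hwR])
      refine le_trans ?_ (((hab s' hs₀' v hv).2).trans hM')
      rcases (norm_nonneg (h w)).eq_or_lt with h0 | h0
      · rw [← h0, Real.log_zero]; exact Real.log_nonneg (hmem _ hs₀' v hv).1
      · exact Real.log_le_log h0 hle
  · intro s _
    exact (hdc.integral_hasStrictDerivAt s₀ s).hasDerivAt
  · exact intervalIntegral.integral_same
  · intro s hs
    rw [hd]; simp only
    rw [le_div_iff₀ (by positivity), one_mul]
    exact (circle_oscillation H.contDiff hk hke hs).1
  · intro s hs
    refine ((circle_oscillation H.contDiff hk hke hs).2 _ _ (hb s hs) (ha s hs)).trans (le_of_eq ?_)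
    rw [hd]; field_simp; ring
  · intro s hs
    have h1 := hC s hs (M s) fun w hw => (hab s hs w hw).2
    rw [hY]; simp only [hd]
    rw [intervalIntegral.integral_div]
    have : (∫ σ in s₀..s, circleEnergy h σ) / (2 * π) ≤ M s + C / (2 * π) := by
      rw [div_le_iff₀ (by positivity), add_mul, div_mul_cancel₀ _ (by positivity)]; linarith
    exact this.trans (by gcongr; exact le_max_left _ _)
  · intro s hs
    have h1 := min_log_norm_le H.contDiff hk hke hs (fun w hw => (hab s hs w hw).1)
      (fun w hw => (hab s₀ le_rfl w hw).2)
    refine h1.trans ?_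
    have := le_max_right (C / (2 * π)) (M s₀ - s₀ / 2)
    rw [hY]; simp only [hd]
    linarith

theorem logPlus_nonneg (x : ℝ) : 0 ≤ logPlus x := le_max_left _ _

theorem logPlus_logPlus_mono {x y : ℝ} (hx : 0 ≤ x) (hxy : x ≤ y) :
    logPlus (logPlus x) ≤ logPlus (logPlus y) :=
  Real.posLog_le_posLog (logPlus_nonneg _) (Real.posLog_le_posLog hx hxy)

theorem logPlus_logPlus_add_le (x y : ℝ) :
    logPlus (logPlus (x + y)) ≤
      logPlus (logPlus x) + (Real.log 2 + logPlus (Real.log 2 + logPlus y)) := by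
  have h1 : logPlus (x + y) ≤ Real.log 2 + logPlus x + logPlus y := Real.posLog_add
  have h2 : logPlus (logPlus x + (Real.log 2 + logPlus y)) ≤
    Real.log 2 + logPlus (logPlus x) + logPlus (Real.log 2 + logPlus y) := Real.posLog_add
  have h3 : logPlus (logPlus (x + y)) ≤ logPlus (logPlus x + (Real.log 2 + logPlus y)) :=
    Real.posLog_le_posLog (logPlus_nonneg _) (by linarith)
  linarith

theorem comap_norm_atTop_eq_cocompact :
    Filter.comap (fun z : ℂ => ‖z‖) Filter.atTop = cocompact ℂ := by
  rw [← Metric.cobounded_eq_cocompact]; exact comap_norm_atTop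

theorem entireOrder_le_of_comparison {f₁ f₂ : ℂ → ℂ} {A : ℝ}
    (H : ∀ ε > 0, ∀ r : ℝ, ∀ᶠ z in cocompact ℂ, logPlus (logPlus ‖f₁ z‖) ≤ A ∨
      ∃ w, r < ‖w‖ ∧ Real.log ‖w‖ ≤ (1 + ε) * Real.log ‖z‖ ∧
        logPlus (logPlus ‖f₁ z‖) ≤ logPlus (logPlus ‖f₂ w‖) + A) :
    entireOrder f₁ ≤ entireOrder f₂ := by
  refine le_of_forall_gt_imp_ge_of_dense fun B hB => ?_
  obtain ⟨b, hb, hbB⟩ := ENNReal.lt_iff_exists_nnreal_btwn.1 hB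
  obtain ⟨b', hbb', hb'B⟩ := ENNReal.lt_iff_exists_nnreal_btwn.1 hbB
  refine le_trans ?_ hb'B.le
  have hbb : (b : ℝ) < b' := by exact_mod_cast hbb'
  have hb0 : (0 : ℝ) ≤ b := b.2
  unfold entireOrder at hb ⊢
  rw [comap_norm_atTop_eq_cocompact] at hb ⊢
  have h2 := eventually_lt_of_limsup_lt hb
  obtain ⟨r, hr⟩ := eventually_cocompact_iff.1 h2
  set ε := ((b' : ℝ) - b) / (2 * (b + 1)) with hε
  have hε0 : 0 < ε := div_pos (by linarith) (by linarith)
  have hbε : b * (1 + ε) ≤ b + (b' - b) / 2 := by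
    have : (b : ℝ) * ε ≤ (b' - b) / 2 := by
      rw [hε, mul_div_assoc', div_le_div_iff₀ (by linarith) (by norm_num)]
      nlinarith
    linarith
  have hlog : Tendsto (fun w : ℂ => Real.log ‖w‖) (cocompact ℂ) atTop :=
    Real.tendsto_log_atTop.comp tendsto_norm_cocompact_atTop
  refine limsup_le_of_le (by isBoundedDefault) ?_
  filter_upwards [H ε hε0 (max r 1), hlog.eventually_gt_atTop 0,
    hlog.eventually_ge_atTop (A / ((b' - b) / 2))] with z hz hz0 hzA
  have hA : A ≤ (b' - b) / 2 * Real.log ‖z‖ := by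
    rwa [div_le_iff₀ (by linarith), mul_comm] at hzA
  rw [← ENNReal.ofReal_coe_nnreal]
  refine ENNReal.ofReal_le_ofReal ?_
  rw [div_le_iff₀ hz0]
  rcases hz with hz | ⟨w, hw, hwz, hfw⟩
  · nlinarith
  · have hw1 : 0 < Real.log ‖w‖ := Real.log_pos ((le_max_right _ _).trans_lt hw)
    have h3 := hr w ((le_max_left _ _).trans_lt hw)
    rw [← ENNReal.ofReal_coe_nnreal] at h3
    have h4 := (ENNReal.lt_ofReal_iff_toReal_lt (ENNReal.ofReal_ne_top)).1 h3
    rw [ENNReal.toReal_ofReal (div_nonneg (logPlus_nonneg _) hw1.le), div_lt_iff₀ hw1] at h4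
    have h5 : (b : ℝ) * Real.log ‖w‖ ≤ b * ((1 + ε) * Real.log ‖z‖) := by gcongr
    nlinarith

theorem entireOrder_eq_of_isNearlyConformal {f g h : ℂ → ℂ} {W : Set ℂ} {R ρ : ℝ} {c : ℂ}
    (H : IsNearlyConformal h W R)
    (hfg : ∀ w, ρ < ‖g w‖ → w ∈ W ∧ f (h w) = g w + c)
    (hsurj : ∀ z v, ρ < ‖v‖ → f z = v + c → ∃ w, g w = v ∧ h w = z) :
    entireOrder f = entireOrder g := by
  set A₀ := Real.log 2 + logPlus (Real.log 2 + logPlus ‖c‖) with hA₀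
  have hA₀0 : 0 ≤ A₀ := add_nonneg (Real.log_nonneg (by norm_num)) (logPlus_nonneg _)
  set A := max A₀ (logPlus (logPlus (max ρ 0 + ‖c‖))) with hA
  have hAρ : ∀ x : ℝ, 0 ≤ x → x ≤ max ρ 0 + ‖c‖ → logPlus (logPlus x) ≤ A := fun x hx0 hx =>
    (logPlus_logPlus_mono hx0 hx).trans (le_max_right _ _)
  have hadd : ∀ x y : ℝ, 0 ≤ x → x ≤ y + ‖c‖ →
      logPlus (logPlus x) ≤ logPlus (logPlus y) + A := fun x y hx hxy =>
    (logPlus_logPlus_mono hx hxy).trans ((logPlus_logPlus_add_le _ _).trans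
      (add_le_add le_rfl (le_max_left _ _)))
  refine le_antisymm (entireOrder_le_of_comparison (A := A) fun ε hε r => ?_)
    (entireOrder_le_of_comparison (A := A) fun ε hε r => ?_)
  · have hε' : 0 < ε / (1 + ε) := by positivity
    obtain ⟨r', hr'⟩ := eventually_cocompact_iff.1 (H.eventually_log_norm hε')
    obtain ⟨D, hD⟩ := (isCompact_closedBall (0 : ℂ) (max r r')).exists_bound_of_continuousOn
      H.contDiff.continuous.continuousOn
    filter_upwards [tendsto_norm_cocompact_atTop.eventually_gt_atTop D] with z hz
    rcases le_or_gt ‖f z - c‖ ρ with hle | hgt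
    · left
      refine hAρ _ (norm_nonneg _) ?_
      calc ‖f z‖ = ‖(f z - c) + c‖ := by rw [sub_add_cancel]
        _ ≤ ‖f z - c‖ + ‖c‖ := norm_add_le _ _
        _ ≤ _ := by gcongr; exact hle.trans (le_max_left _ _)
    · right
      obtain ⟨w, hgw, hhw⟩ := hsurj z (f z - c) hgt (by ring)
      have hw : max r r' < ‖w‖ := by
        by_contra hcon
        have := hD w (by rw [mem_closedBall_zero_iff]; exact not_lt.1 hcon)
        rw [hhw] at this; linarith
      have hwW := (hfg w (by rw [hgw]; exact hgt)).1
      refine ⟨w, (le_max_left _ _).trans_lt hw, ?_, ?_⟩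
      · have h1 := (hr' w ((le_max_right _ _).trans_lt hw) hwW).1
        rw [hhw] at h1
        have e : 1 - ε / (1 + ε) = 1 / (1 + ε) := by field_simp; ring
        rw [e, one_div_mul_eq_div, div_le_iff₀ (by positivity)] at h1
        linarith
      · refine hadd _ _ (norm_nonneg _) ?_
        rw [hgw]
        calc ‖f z‖ = ‖(f z - c) + c‖ := by rw [sub_add_cancel]
          _ ≤ ‖f z - c‖ + ‖c‖ := norm_add_le _ _
  · filter_upwards [H.eventually_log_norm hε,
      H.tendsto.eventually (tendsto_norm_cocompact_atTop.eventually_gt_atTop r)] with w hw hwr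
    rcases le_or_gt ‖g w‖ ρ with hle | hgt
    · left
      exact hAρ _ (norm_nonneg _) (by linarith [norm_nonneg c, le_max_left ρ 0])
    · right
      obtain ⟨hwW, hf⟩ := hfg w hgt
      refine ⟨h w, hwr, (hw hwW).2, hadd _ _ (norm_nonneg _) ?_⟩
      rw [hf]
      calc ‖g w‖ = ‖(g w + c) - c‖ := by rw [add_sub_cancel_right]
        _ ≤ ‖g w + c‖ + ‖c‖ := norm_sub_le _ _

theorem exists_lt_norm_of_not_const {g : ℂ → ℂ} (hg : Differentiable ℂ g)
    (hgnc : ¬ ∃ c, ∀ z, g z = c) (ρ : ℝ) : ∃ w, ρ < ‖g w‖ := by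
  by_contra hcon
  push Not at hcon
  refine hgnc (hg.exists_const_forall_eq_of_bounded ?_)
  exact (Metric.isBounded_closedBall (x := (0 : ℂ)) (r := ρ)).subset
    (range_subset_iff.2 fun w => by simpa using hcon w)

theorem entireOrder_eq_of_incrementsHaveLog {f g : ℂ → ℂ} (hf : Differentiable ℂ f)
    (hnc : ¬ ∃ c, ∀ z, f z = c) (hfin : (singularSet f).Finite) (harea : AreaProperty f)
    (hg : Differentiable ℂ g) {Φ Ψ : ℂ ≃ₜ ℂ} (hfg : ∀ w, f (Φ w) = Ψ (g w))
    (hlog : IncrementsHaveLog Ψ) : entireOrder f = entireOrder g := by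
  have hgnc : ¬ ∃ c, ∀ z, g z = c := fun ⟨c, hc⟩ => hnc ⟨Ψ c, fun z => by
    rw [← Φ.apply_symm_apply z, hfg, hc]⟩
  set S := insert 0 (singularSet f)
  have hS : S.Finite := hfin.insert 0
  have hfS : singularSet f ⊆ S := subset_insert _ _
  obtain ⟨G, χ, V, c, ρ, hM⟩ := exists_model_map hlog hS (insert_nonempty _ _)
  obtain ⟨h, hh, hfh, hinj, hsurj, hprop⟩ :=
    exists_comparison_map hf hnc hg.continuous hS hfS hfg hM
  obtain ⟨h1, h2, h3, h4, h5⟩ := hM.comparison_regular hf hg hgnc hS hfS hh hfh hinj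
  have hQ : IsCompact Vᶜ := by
    refine isCompact_of_isClosed_isBounded hM.isOpen.isClosed_compl ?_
    refine (Metric.isBounded_closedBall (x := (0 : ℂ)) (r := ρ)).subset fun v hv => ?_
    rw [mem_closedBall_zero_iff]
    exact not_lt.1 fun hlt => hv (hM.infty v hlt).1
  have hVS : ∀ v ∈ Vᶜ, Ψ v ∉ S := fun v hv hm => hv (hM.mem_of_mem v hm)
  obtain ⟨R, hR⟩ := harea.exists_energy_lt_top hf hg hh hM.contDiff hQ hfh hinj
    (by
      rintro _ ⟨v, hv, rfl⟩ hmem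
      refine hVS v hv ?_
      rw [← hM.mem_iff 1 v, hM.one]
      exact hfS hmem)
    (fun w hw => by
      have hmem : f (Φ w) ∉ singularSet f := by
        rw [hfg]; exact fun hm => hVS _ hw (hfS hm)
      obtain ⟨U, hU, hwU, hUi⟩ := exists_injOn_of_notMem_singularSet hf.continuous hmem
      refine ⟨Φ ⁻¹' U, hU.preimage Φ.continuous, hwU, fun x hx y hy hxy => ?_⟩
      exact Φ.injective (hUi hx hy (by rw [hfg, hfg, hxy])))
    (fun w hw => h5 w (hVS _ hw))
  obtain ⟨w₀, hw₀⟩ := exists_lt_norm_of_not_const hg hgnc ρ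
  have H : IsNearlyConformal h (g ⁻¹' V) R :=
    { contDiff := h1
      isOpen := hM.isOpen.preimage hg.continuous
      nonempty := ⟨w₀, (hM.infty _ hw₀).1⟩
      tendsto := hprop
      differentiableOn := h2
      inj := h3
      deriv_ne_zero := h4
      energy := hR }
  refine entireOrder_eq_of_isNearlyConformal (ρ := ρ) (c := c) H (fun w hw => ?_)
    fun z v hv hz => hsurj z v (by rw [hz, (hM.infty v hv).2])
  exact ⟨(hM.infty _ hw).1, by rw [hfh, (hM.infty _ hw).2]⟩

theorem entireOrder_conj_conj (g : ℂ → ℂ) :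
    entireOrder (fun z => starRingEnd ℂ (g (starRingEnd ℂ z))) = entireOrder g := by
  have hmap : Filter.map (starRingEnd ℂ) (cocompact ℂ) = cocompact ℂ :=
    conjCLE.toHomeomorph.map_cocompact
  unfold entireOrder
  rw [comap_norm_atTop_eq_cocompact]
  conv_rhs => rw [← hmap]
  simp only [limsup, limsSup, Filter.map_map, Function.comp_def, norm_conj]

theorem area_property_implies_invariance_of_order (f : ℂ → ℂ)
    (hf : TranscendentalEntire f) (hfin : (singularSet f).Finite)
    (harea : AreaProperty f)
    (g : ℂ → ℂ) (hg : Differentiable ℂ g) (heq : TopEquiv f g) :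
    entireOrder f = entireOrder g := by
  obtain ⟨φ, ψ, hφψ⟩ := heq
  have hnc : ¬ ∃ c, ∀ z, f z = c := fun ⟨c, hc⟩ => hf.2 ⟨Polynomial.C c, fun z => by simp [hc]⟩
  have hfg : ∀ w, f (φ.symm w) = ψ.symm (g w) := fun w => by
    rw [Homeomorph.eq_symm_apply, hφψ, φ.apply_symm_apply]
  rcases incrementsHaveLog_or ψ.symm with hlog | hlog
  · exact entireOrder_eq_of_incrementsHaveLog hf.1 hnc hfin harea hg hfg hlog
  · rw [← entireOrder_conj_conj g]
    have hg' : Differentiable ℂ fun z => starRingEnd ℂ (g (starRingEnd ℂ z)) := fun z => by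
      have := (hg (starRingEnd ℂ z)).conj_conj
      rwa [Complex.conj_conj] at this
    refine entireOrder_eq_of_incrementsHaveLog hf.1 hnc hfin harea hg'
      (Φ := conjCLE.toHomeomorph.trans φ.symm) (Ψ := conjCLE.toHomeomorph.trans ψ.symm) ?_ hlog
    intro w
    simp [hfg]
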